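/- arXiv:1810.12053 — 2 statements merged into one kernel-verified Lean document; each statement's English description precedes it below -/
import Mathlib

section
/- The elements a₁ a₂ ⋯ aₙ of H(d,1,n), indexed by tuples (a₁, a₂, …, aₙ) where a₁ ranges over the d listed expressions of Λ₁ and aᵢ ranges over the i·d listed expressions of Λᵢ for 2 ≤ i ≤ n, are pairwise distinct and form an R₀-basis of H(d,1,n): they are R₀-linearly independent and they span H(d,1,n) as an R₀-module. (There are d^n·n! such elements.) -/
noncomputable section

open scoped Pointwise

/-- The base ring `R₀ = ℤ[a, b₁, …, b_{d-1}]`, with `a` the variable of index `0`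
and `b_i` the variable of index `i` for `1 ≤ i ≤ d-1`. -/
abbrev R0 (d : ℕ) : Type := MvPolynomial (Fin d) ℤ

/-- The variable `a ∈ R₀`. -/
def aV (d : ℕ) : R0 d := if h : 0 < d then MvPolynomial.X (⟨0, h⟩ : Fin d) else 0

/-- The variable `b_i ∈ R₀` for `1 ≤ i ≤ d-1`. -/
def bV (d i : ℕ) : R0 d := if h : i < d then MvPolynomial.X (⟨i, h⟩ : Fin d) else 0

/-- Generators of the classical presentation of the Hecke algebra `H(d,1,n)`:
`z` and `s_j` for `2 ≤ j ≤ n`. -/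
inductive HGen (n : ℕ) : Type
  | z : HGen n
  | s : (j : ℕ) → 2 ≤ j → j ≤ n → HGen n

open FreeAlgebra

/-- The free `R₀`-algebra on the generators. -/
abbrev FA (d n : ℕ) : Type := FreeAlgebra (R0 d) (HGen n)

/-- The defining relations of the Hecke algebra `H(d,1,n)`. -/
inductive HRel (d n : ℕ) : FA d n → FA d n → Prop
  | zszs (h : 2 ≤ n) :
      HRel d n (ι (R0 d) HGen.z * ι (R0 d) (HGen.s 2 le_rfl h) *
                  ι (R0 d) HGen.z * ι (R0 d) (HGen.s 2 le_rfl h))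
               (ι (R0 d) (HGen.s 2 le_rfl h) * ι (R0 d) HGen.z *
                  ι (R0 d) (HGen.s 2 le_rfl h) * ι (R0 d) HGen.z)
  | zs (j : ℕ) (h2 : 2 ≤ j) (h3 : 3 ≤ j) (hn : j ≤ n) :
      HRel d n (ι (R0 d) HGen.z * ι (R0 d) (HGen.s j h2 hn))
               (ι (R0 d) (HGen.s j h2 hn) * ι (R0 d) HGen.z)
  | braid (i : ℕ) (h2 : 2 ≤ i) (h2' : 2 ≤ i + 1) (hn' : i ≤ n) (hn : i + 1 ≤ n) :
      HRel d n (ι (R0 d) (HGen.s i h2 hn') * ι (R0 d) (HGen.s (i + 1) h2' hn) *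
                  ι (R0 d) (HGen.s i h2 hn'))
               (ι (R0 d) (HGen.s (i + 1) h2' hn) * ι (R0 d) (HGen.s i h2 hn') *
                  ι (R0 d) (HGen.s (i + 1) h2' hn))
  | comm (i j : ℕ) (h2i : 2 ≤ i) (hni : i ≤ n) (h2j : 2 ≤ j) (hnj : j ≤ n)
      (hij : i + 1 < j ∨ j + 1 < i) :
      HRel d n (ι (R0 d) (HGen.s i h2i hni) * ι (R0 d) (HGen.s j h2j hnj))
               (ι (R0 d) (HGen.s j h2j hnj) * ι (R0 d) (HGen.s i h2i hni))
  | zd :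
      HRel d n (ι (R0 d) HGen.z ^ d)
               ((∑ i ∈ Finset.Icc 1 (d - 1),
                  algebraMap (R0 d) (FA d n) (bV d i) * ι (R0 d) HGen.z ^ (d - i)) + 1)
  | sq (j : ℕ) (h2 : 2 ≤ j) (hn : j ≤ n) :
      HRel d n (ι (R0 d) (HGen.s j h2 hn) * ι (R0 d) (HGen.s j h2 hn))
               (algebraMap (R0 d) (FA d n) (aV d) * ι (R0 d) (HGen.s j h2 hn) + 1)

/-- The Hecke algebra `H(d,1,n)`. -/
abbrev Hecke (d n : ℕ) : Type := RingQuot (HRel d n)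

/-- The generator `z` of `H(d,1,n)`. -/
def zH (d n : ℕ) : Hecke d n :=
  RingQuot.mkAlgHom (R0 d) (HRel d n) (ι (R0 d) HGen.z)

/-- The generator `s_j` of `H(d,1,n)` (junk value `1` when `j` is out of range). -/
def sH (d n : ℕ) (j : ℕ) : Hecke d n :=
  if h : 2 ≤ j ∧ j ≤ n then RingQuot.mkAlgHom (R0 d) (HRel d n) (ι (R0 d) (HGen.s j h.1 h.2))
  else 1

/-- Decreasing-index product `s_m s_{m-1} ⋯ s_{i'}` (empty when `m < i'`). -/
def sDescH (d n m i' : ℕ) : Hecke d n :=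
  (((List.range' i' (m + 1 - i')).reverse).map (sH d n)).prod

/-- Increasing-index product `s_{i'} s_{i'+1} ⋯ s_m` (empty when `m < i'`). -/
def sAscH (d n i' m : ℕ) : Hecke d n :=
  ((List.range' i' (m + 1 - i')).map (sH d n)).prod

/-- `Λ₁ = {z^k : 0 ≤ k ≤ d-1}` in `H(d,1,n)`. -/
def Lam1 (d n : ℕ) : Set (Hecke d n) := {x | ∃ k < d, x = zH d n ^ k}

/-- `Λ_m = {1} ∪ {s_m ⋯ s_{i'} : 2 ≤ i' ≤ m} ∪ {s_m ⋯ s₂ z^k : 1 ≤ k ≤ d-1}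
∪ {s_m ⋯ s₂ z^k s₂ s₃ ⋯ s_{i'} : 1 ≤ k ≤ d-1, 2 ≤ i' ≤ m}` in `H(d,1,n)`. -/
def LamG (d n m : ℕ) : Set (Hecke d n) :=
  {1} ∪ {x | ∃ i', 2 ≤ i' ∧ i' ≤ m ∧ x = sDescH d n m i'} ∪
    {x | ∃ k, 1 ≤ k ∧ k < d ∧ x = sDescH d n m 2 * zH d n ^ k} ∪
    {x | ∃ k, 1 ≤ k ∧ k < d ∧ ∃ i', 2 ≤ i' ∧ i' ≤ m ∧
      x = sDescH d n m 2 * zH d n ^ k * sAscH d n 2 i'}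


/-- Index type enumerating the `m·d` listed expressions of `Λ_m` for `2 ≤ m ≤ n`. -/
inductive LamIdx (d m : ℕ) : Type
  | one : LamIdx d m
  | sdesc (i' : ℕ) (h2 : 2 ≤ i') (hi : i' ≤ m) : LamIdx d m
  | sz (k : ℕ) (hk1 : 1 ≤ k) (hk : k < d) : LamIdx d m
  | szs (k : ℕ) (hk1 : 1 ≤ k) (hk : k < d) (i' : ℕ) (h2 : 2 ≤ i') (hi : i' ≤ m) : LamIdx d m

/-- Evaluation of a listed expression of `Λ_m` in `H(d,1,n)`. -/
def lamEvalH (d n m : ℕ) : LamIdx d m → Hecke d n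
  | .one => 1
  | .sdesc i' _ _ => sDescH d n m i'
  | .sz k _ _ => sDescH d n m 2 * zH d n ^ k
  | .szs k _ _ i' _ _ => sDescH d n m 2 * zH d n ^ k * sAscH d n 2 i'

/-- The element `a₁ a₂ ⋯ aₙ` of `H(d,1,n)` indexed by an exponent `0 ≤ k ≤ d-1`
(for `a₁ = z^k ∈ Λ₁`) and a tuple of listed expressions of `Λ₂, …, Λₙ`. -/
def nfH (d n : ℕ) (p : Fin d × (∀ j : Fin (n - 1), LamIdx d (j.val + 2))) : Hecke d n :=
  zH d n ^ (p.1 : ℕ) *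
    ((List.finRange (n - 1)).map (fun j : Fin (n - 1) => lamEvalH d n (j.val + 2) (p.2 j))).prod

/-- The relations of the Hecke algebra, in an arbitrary algebra. -/
structure HR {R A : Type*} [CommRing R] [Ring A] [Algebra R A] (d n : ℕ) (a : R) (b : ℕ → R)
    (z : A) (s : ℕ → A) : Prop where
  zszs : 2 ≤ n → z * s 2 * z * s 2 = s 2 * z * s 2 * z
  zs : ∀ j, 3 ≤ j → j ≤ n → z * s j = s j * z
  braid : ∀ i, 2 ≤ i → i + 1 ≤ n → s i * s (i+1) * s i = s (i+1) * s i * s (i+1)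
  comm : ∀ i j, 2 ≤ i → j ≤ n → i + 1 < j → s i * s j = s j * s i
  zd : z ^ d = (∑ i ∈ Finset.Icc 1 (d-1), algebraMap R A (b i) * z ^ (d-i)) + 1
  sq : ∀ j, 2 ≤ j → j ≤ n → s j * s j = algebraMap R A a * s j + 1

/-- The action of the generators `s_j` on a string `P 1, …, P n`. -/
structure PS {B M : Type*} [Ring B] [AddCommGroup M] [Module B M] (n : ℕ) (α β : B)
    (s : ℕ → B) (S : ℕ → M →ₗ[B] M) (P : ℕ → M) : Prop where
  up : ∀ i, 1 ≤ i → i + 1 ≤ n → S (i+1) (P i) = α • P i + P (i+1)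
  dn : ∀ i, 1 ≤ i → i + 1 ≤ n → S (i+1) (P (i+1)) = β • P (i+1) + P i
  lo : ∀ i j, 2 ≤ j → j < i → i ≤ n → S j (P i) = s j • P i
  hi : ∀ i j, 1 ≤ i → i + 1 ≤ j → j + 1 ≤ n → S (j+1) (P i) = s j • P i

section PSsec
variable {R B M : Type*} [CommRing R] [Ring B] [Algebra R B] [AddCommGroup M] [Module B M]
  {d m : ℕ} {a : R} {b : ℕ → R} {z : B} {s : ℕ → B} {α β : B} {S : ℕ → M →ₗ[B] M} {P : ℕ → M}

theorem PS.sq (h : PS (m+1) α β s S P) (hB : HR d m a b z s)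
    (hs : α + β = algebraMap R B a) (h1 : α * β = 0) (h2 : β * α = 0)
    (i j : ℕ) (hi1 : 1 ≤ i) (hi2 : i ≤ m + 1) (hj1 : 2 ≤ j) (hj2 : j ≤ m + 1) :
    S j (S j (P i)) = algebraMap R B a • S j (P i) + P i := by
  obtain ⟨j, rfl⟩ : ∃ j', j = j' + 1 := ⟨j - 1, by omega⟩
  rcases lt_trichotomy i j with hij | hij | hij
  · rw [h.hi i j hi1 hij hj2, map_smul, h.hi i j hi1 hij hj2, smul_smul,
      hB.sq j (by omega) (by omega), add_smul, mul_smul, one_smul]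
  · subst hij
    rw [h.up i hi1 hj2, map_add, map_smul, h.up i hi1 hj2, h.dn i hi1 hj2, ← hs]
    have : α • α • P i = (α + β) • α • P i := by
      rw [smul_smul, smul_smul, add_mul, h2, add_zero]
    rw [smul_add, smul_add, this, add_smul α β (P (i+1))]; abel
  · rcases eq_or_lt_of_le (Nat.succ_le_of_lt hij) with hij | hij
    · subst hij
      rw [Nat.succ_eq_add_one, h.dn j (by omega) hj2, map_add, map_smul, h.up j (by omega) hj2, h.dn j (by omega) hj2, ← hs]
      have : β • β • P (j+1) = (α + β) • β • P (j+1) := by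
        rw [smul_smul, smul_smul, add_mul, h1, zero_add]
      rw [smul_add, smul_add, this, add_smul α β (P (j))]; abel
    · rw [h.lo i (j+1) hj1 hij hi2, map_smul, h.lo i (j+1) hj1 hij hi2, smul_smul,
        hB.sq (j+1) (by omega) (by omega), add_smul, mul_smul, one_smul]

theorem PS.comm (h : PS (m+1) α β s S P) (hB : HR d m a b z s)
    (cα : ∀ x, α * x = x * α) (cβ : ∀ x, β * x = x * β)
    (i j k : ℕ) (hi1 : 1 ≤ i) (hi2 : i ≤ m + 1) (hj1 : 2 ≤ j) (hk2 : k ≤ m + 1) (hjk : j + 1 < k) :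
    S j (S k (P i)) = S k (S j (P i)) := by
  obtain ⟨j, rfl⟩ : ∃ j', j = j' + 1 := ⟨j - 1, by omega⟩
  obtain ⟨k, rfl⟩ : ∃ k', k = k' + 1 := ⟨k - 1, by omega⟩
  rcases lt_trichotomy i j with hij | hij | hij
  · rw [h.hi i j hi1 hij (by omega), h.hi i k hi1 (by omega) (by omega), map_smul, map_smul,
      h.hi i j hi1 hij (by omega), h.hi i k hi1 (by omega) (by omega), smul_smul, smul_smul,
      hB.comm j k (by omega) (by omega) (by omega)]
  · subst hij
    rw [h.hi i k hi1 (by omega) (by omega), h.up i hi1 (by omega), map_smul, map_add, map_smul,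
      h.hi i k hi1 (by omega) (by omega), h.up i hi1 (by omega),
      h.hi (i+1) k (by omega) (by omega) (by omega), smul_add, smul_smul, smul_smul, cα]
  · rcases eq_or_lt_of_le (Nat.succ_le_of_lt hij) with hij | hij
    · subst hij
      rw [Nat.succ_eq_add_one, h.hi (j+1) k (by omega) (by omega) (by omega), h.dn j (by omega) (by omega),
        map_smul, map_add, map_smul, h.hi (j+1) k (by omega) (by omega) (by omega),
        h.dn j (by omega) (by omega), h.hi j k (by omega) (by omega) (by omega),
        smul_add, smul_smul, smul_smul, cβ]
    · have e1 := h.lo i (j+1) hj1 hij hi2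
      rw [e1, map_smul]
      rcases lt_trichotomy i k with hik | hik | hik
      · rw [h.hi i k hi1 hik hk2, map_smul, e1, smul_smul, smul_smul,
          hB.comm (j+1) k (by omega) (by omega) (by omega)]
      · subst hik
        rw [h.up i hi1 hk2, map_add, map_smul, e1, h.lo (i+1) (j+1) hj1 (by omega) hk2, smul_add,
          smul_smul, smul_smul, cα]
      · rcases eq_or_lt_of_le (Nat.succ_le_of_lt hik) with hik | hik
        · subst hik
          rw [Nat.succ_eq_add_one] at *
          rw [h.dn k (by omega) hk2, map_add, map_smul, e1, h.lo k (j+1) hj1 (by omega) (by omega),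
            smul_add, smul_smul, smul_smul, cβ]
        · rw [h.lo i (k+1) (by omega) hik hi2, map_smul, e1, smul_smul, smul_smul,
            hB.comm (j+1) (k+1) hj1 (by omega) (by omega)]

theorem PS.braid (h : PS (m+1) α β s S P) (hB : HR d m a b z s)
    (cα : ∀ x, α * x = x * α) (cβ : ∀ x, β * x = x * β)
    (hs : α + β = algebraMap R B a) (h1 : α * β = 0) 
    (i j : ℕ) (hi1 : 1 ≤ i) (hi2 : i ≤ m + 1) (hj1 : 2 ≤ j) (hj2 : j + 1 ≤ m + 1) :
    S j (S (j+1) (S j (P i))) = S (j+1) (S j (S (j+1) (P i))) := by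
  have h2 : β * α = 0 := by rw [← cα, h1]
  obtain ⟨j, rfl⟩ : ∃ j', j = j' + 1 := ⟨j - 1, by omega⟩
  have hsq := hB.sq (j+1) (by omega) (by omega)
  rw [← hs] at hsq
  have c1' := (cα (s (j+1))).symm
  have c2' := (cβ (s (j+1))).symm
  have c1'' : ∀ x, s (j+1) * (α * x) = α * (s (j+1) * x) := fun x => by
    rw [← mul_assoc, c1', mul_assoc]
  have c2'' : ∀ x, s (j+1) * (β * x) = β * (s (j+1) * x) := fun x => by
    rw [← mul_assoc, c2', mul_assoc]
  have hβα : ∀ x, β * (α * x) = 0 := fun x => by rw [← mul_assoc, h2, zero_mul]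
  have hαβ : ∀ x, α * (β * x) = 0 := fun x => by rw [← mul_assoc, h1, zero_mul]
  by_cases hc1 : i < j
  · have e1 := h.hi i j hi1 hc1 (by omega)
    have e2 := h.hi i (j+1) hi1 (by omega) (by omega)
    simp only [e1, e2, map_smul, smul_smul]
    rw [hB.braid j (by omega) (by omega)]
  by_cases hc2 : i = j
  · subst hc2
    have e1 := h.up i hi1 (by omega)
    have e2 := h.dn i hi1 (by omega)
    have e3 := h.up (i+1) (by omega) (by omega)
    have e4 := h.hi i (i+1) hi1 (by omega) (by omega)
    have e5 := h.lo (i+1+1) (i+1) (by omega) (by omega) (by omega)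
    simp only [e1, e2, e3, e4, e5, map_smul, map_add, smul_smul, smul_add]
    match_scalars
    all_goals
      simp only [mul_one, mul_assoc, mul_add, add_mul, c1', c1'', c2', c2'', hsq, h1, h2, hβα, hαβ, mul_zero, add_zero, zero_add, zero_mul]
  by_cases hc3 : i = j + 1
  · subst hc3
    have e1 := h.up j (by omega) (by omega)
    have e2 := h.dn j (by omega) (by omega)
    have e3 := h.up (j+1) (by omega) (by omega)
    have e6 := h.dn (j+1) (by omega) (by omega)
    have e4 := h.hi j (j+1) (by omega) (by omega) (by omega)
    have e5 := h.lo (j+1+1) (j+1) (by omega) (by omega) (by omega)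
    simp only [e1, e2, e3, e4, e5, e6, map_smul, map_add, smul_smul, smul_add]
    match_scalars
    all_goals
      simp only [mul_one, mul_assoc, mul_add, add_mul, c1', c1'', c2', c2'', hsq, h1, h2, hβα, hαβ, mul_zero, add_zero, zero_add, zero_mul]
  by_cases hc4 : i = j + 2
  · subst hc4
    have e1 := h.up j (by omega) (by omega)
    have e2 := h.dn j (by omega) (by omega)
    have e3 := h.up (j+1) (by omega) (by omega)
    have e6 := h.dn (j+1) (by omega) (by omega)
    have e4 := h.hi j (j+1) (by omega) (by omega) (by omega)
    have e5 := h.lo (j+1+1) (j+1) (by omega) (by omega) (by omega)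
    have e7 : P (j+2) = P (j+1+1) := rfl
    simp only [e7, e1, e2, e3, e4, e5, e6, map_smul, map_add, smul_smul, smul_add]
    match_scalars
    all_goals
      simp only [mul_one, mul_assoc, mul_add, add_mul, c1', c1'', c2', c2'', hsq, h1, h2, hβα, hαβ, mul_zero, add_zero, zero_add, zero_mul]
  · have e1 := h.lo i (j+1) (by omega) (by omega) hi2
    have e2 := h.lo i (j+1+1) (by omega) (by omega) hi2
    simp only [e1, e2, map_smul, smul_smul]
    rw [hB.braid (j+1) (by omega) (by omega)]
end PSsec

section WS
variable {R B : Type*} [CommRing R] [Ring B] [Algebra R B]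
  {d m : ℕ} {a : R} {b : ℕ → R} {z : B} {s : ℕ → B}

/-- `WW s t = s₂ s₃ ⋯ s_{t+1}`. -/
def WW (s : ℕ → B) : ℕ → B
  | 0 => 1
  | t + 1 => WW s t * s (t + 2)

theorem HR.W_comm (hB : HR d m a b z s) (t j : ℕ) (h1 : t + 3 ≤ j) (h2 : j ≤ m) :
    WW s t * s j = s j * WW s t := by
  induction t with
  | zero => simp [WW]
  | succ t ih =>
    simp only [WW]
    rw [mul_assoc, hB.comm (t+2) j (by omega) h2 (by omega), ← mul_assoc, ih (by omega), mul_assoc]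

theorem HR.W_lo (hB : HR d m a b z s) (t j : ℕ) (hj : 2 ≤ j) (h1 : j ≤ t) (h2 : t + 1 ≤ m) :
    WW s t * s j = s (j+1) * WW s t := by
  induction t with
  | zero => omega
  | succ t ih =>
    simp only [WW]
    rcases eq_or_lt_of_le h1 with h | h
    · subst h
      obtain ⟨t, rfl⟩ : ∃ t', t = t' + 1 := ⟨t - 1, by omega⟩
      have hb := hB.braid (t+2) (by omega) (by omega)
      have hc := hB.W_comm t (t+2+1) (by omega) (by omega)
      simp only [WW]
      calc WW s t * s (t+2) * s (t+1+2) * s (t+1+1)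
          = WW s t * (s (t+2) * s (t+2+1) * s (t+2)) := by simp only [mul_assoc]
        _ = (WW s t * s (t+2+1)) * s (t+2) * s (t+2+1) := by rw [hb]; simp only [mul_assoc]
        _ = _ := by rw [hc]; simp only [mul_assoc]
    · rw [mul_assoc, ← hB.comm j (t+2) (by omega) (by omega) (by omega), ← mul_assoc,
        ih (by omega) (by omega), mul_assoc]

theorem HR.W_split (hB : HR d m a b z s) (t : ℕ) (h2 : t + 2 ≤ m) :
    ∃ w, WW s (t+1) = s 2 * w ∧ w * z = z * w := by
  induction t with
  | zero => exact ⟨1, by simp [WW], by simp⟩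
  | succ t ih =>
    obtain ⟨w, h1, h3⟩ := ih (by omega)
    refine ⟨w * s (t+3), ?_, ?_⟩
    · rw [WW, h1, mul_assoc]
    · rw [mul_assoc, ← hB.zs (t+3) (by omega) (by omega), ← mul_assoc, h3, mul_assoc]

theorem HR.sq' (hB : HR d m a b z s) (j : ℕ) (h1 : 2 ≤ j) (h2 : j ≤ m) :
    s j * s j = a • s j + 1 := by rw [hB.sq j h1 h2, Algebra.smul_def]

theorem HR.t_comm (hB : HR d m a b z s) (hm : 2 ≤ m) (k : ℕ) :
    s 2 * z * s 2 * z ^ k = z ^ k * (s 2 * z * s 2) := by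
  have h : Commute (s 2 * z * s 2) z := by
    have := hB.zszs hm
    simp only [Commute, SemiconjBy]
    rw [← this]; simp only [mul_assoc]
  exact h.pow_right k

theorem HR.star (hB : HR d m a b z s) (hm : 2 ≤ m) (k : ℕ) :
    s 2 * z ^ k * s 2 * z = z * s 2 * z ^ k * s 2 + a • (z ^ k * s 2 * z) - a • (z * s 2 * z ^ k) := by
  have hs := hB.sq' 2 le_rfl hm
  have ht := hB.t_comm hm k
  have hinv : s 2 * (s 2 - algebraMap R B a) = 1 := by
    rw [mul_sub, hs, ← Algebra.commutes, ← Algebra.smul_def]; abel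
  have e1 : s 2 * z ^ k * s 2 * z = s 2 * (z ^ k * (s 2 * z * s 2)) * (s 2 - algebraMap R B a) := by
    have : s 2 * (z ^ k * (s 2 * z * s 2)) * (s 2 - algebraMap R B a)
      = s 2 * z ^ k * s 2 * z * (s 2 * (s 2 - algebraMap R B a)) := by simp only [mul_assoc]
    rw [this, hinv, mul_one]
  have e2 : z ^ k * s 2 * z = (z ^ k * (s 2 * z * s 2)) * (s 2 - algebraMap R B a) := by
    have : (z ^ k * (s 2 * z * s 2)) * (s 2 - algebraMap R B a)
      = z ^ k * s 2 * z * (s 2 * (s 2 - algebraMap R B a)) := by simp only [mul_assoc]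
    rw [this, hinv, mul_one]
  rw [e1, e2, ← ht]
  have e3 : s 2 * (s 2 * z * s 2 * z ^ k) = (s 2 * s 2) * z * s 2 * z ^ k := by simp only [mul_assoc]
  rw [e3, hs, Algebra.algebraMap_eq_smul_one]
  simp only [mul_sub, add_mul, one_mul, smul_mul_assoc, mul_smul_comm, mul_one, mul_assoc, smul_sub]
  module
end WS

/-- Module data: an explicit action of the generators. -/
structure MD {R B M : Type*} [CommRing R] [Ring B] [Algebra R B] [AddCommGroup M] [Module B M]
    (d m : ℕ) (a : R) (b : ℕ → R) (z : B) (s : ℕ → B) (D : ℕ → M) (F : ℕ → ℕ → M)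
    (S : ℕ → M →ₗ[B] M) (Z : M →ₗ[B] M) : Prop where
  Dps : PS (m+1) (algebraMap R B a) 0 s S (fun i => D (i+1))
  Fps : ∀ k, 1 ≤ k → k < d → PS (m+1) 0 (algebraMap R B a) s S (F k)
  zD : ∀ i, 3 ≤ i → i ≤ m + 2 → Z (D i) = z • D i
  zE0 : Z (D 2) = F 1 1
  zE : ∀ k, 1 ≤ k → k + 1 < d → Z (F k 1) = F (k+1) 1
  zEd : Z (F (d-1) 1) = ∑ i ∈ Finset.Icc 1 (d-1), algebraMap R B (b i) • F (d-i) 1 + D 2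
  zF : ∀ k t, 1 ≤ k → k < d → t + 1 ≤ m → Z (F k (t+2)) =
    z • F k (t+2) + algebraMap R B a • (z ^ k * WW s t) • F 1 1
      - algebraMap R B a • (z * WW s t) • F k 1

section MDsec
variable {R B M : Type*} [CommRing R] [Ring B] [Algebra R B] [AddCommGroup M] [Module B M]
  {d m : ℕ} {a : R} {b : ℕ → R} {z : B} {s : ℕ → B} {D : ℕ → M} {F : ℕ → ℕ → M}
  {S : ℕ → M →ₗ[B] M} {Z : M →ₗ[B] M}

theorem MD.Epow (h : MD d m a b z s D F S Z) (k : ℕ) (h1 : 1 ≤ k) (h2 : k < d) :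
    (Z ^ k) (D 2) = F k 1 := by
  induction k with
  | zero => omega
  | succ k ih =>
    rw [pow_succ', Module.End.mul_apply]
    rcases Nat.eq_zero_or_pos k with h0 | h0
    · subst h0; simp [h.zE0]
    · rw [ih h0 (by omega), h.zE k h0 h2]

theorem MD.Ed (h : MD d m a b z s D F S Z) (hd : 2 ≤ d) :
    (Z ^ d) (D 2) = ∑ i ∈ Finset.Icc 1 (d-1), algebraMap R B (b i) • (Z ^ (d-i)) (D 2) + D 2 := by
  obtain ⟨e, rfl⟩ : ∃ e, d = e + 1 := ⟨d - 1, by omega⟩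
  have := h.zEd
  rw [pow_succ', Module.End.mul_apply, h.Epow e (by omega) (by omega)]
  simp only [Nat.add_sub_cancel] at this ⊢
  rw [this]
  congr 1
  refine Finset.sum_congr rfl fun i hi => ?_
  rw [Finset.mem_Icc] at hi
  rw [h.Epow _ (by omega) (by omega)]

/-- `z^d` relation on vectors. -/
def ZD (d : ℕ) (b : ℕ → R) (Z : M →ₗ[B] M) (x : M) : Prop :=
  (Z ^ d) x = ∑ i ∈ Finset.Icc 1 (d-1), algebraMap R B (b i) • (Z ^ (d-i)) x + x

theorem ZD.add {x y : M} (hx : ZD d b Z x) (hy : ZD d b Z y) : ZD d b Z (x + y) := by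
  unfold ZD at *
  simp only [map_add, hx, hy, smul_add, Finset.sum_add_distrib]; abel

theorem ZD.smul {x : M} (c : B) (hx : ZD d b Z x) : ZD d b Z (c • x) := by
  unfold ZD at *
  simp only [map_smul, hx, smul_add, Finset.smul_sum]
  congr 1
  refine Finset.sum_congr rfl fun i _ => ?_
  rw [smul_smul, smul_smul, Algebra.commutes]

theorem ZD.sum {ι : Type*} {f : ι → M} (t : Finset ι) (hx : ∀ i ∈ t, ZD d b Z (f i)) :
    ZD d b Z (∑ i ∈ t, f i) := by
  classical
  induction t using Finset.induction_on with
  | empty => simp [ZD]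
  | insert i t hi ih =>
    rw [Finset.sum_insert hi]
    exact (hx i (by simp)).add (ih fun j hj => hx j (by simp [hj]))

theorem ZD.Zapp {x : M} (hx : ZD d b Z x) : ZD d b Z (Z x) := by
  unfold ZD at *
  have hc : ∀ k, (Z ^ k) (Z x) = Z ((Z ^ k) x) := fun k => by
    rw [← Module.End.mul_apply, ← pow_succ, pow_succ', Module.End.mul_apply]
  simp only [hc, hx, map_add, map_sum, map_smul]

theorem ZD.of_eig (hB : HR d m a b z s) {x : M} (hx : Z x = z • x) : ZD d b Z x := by
  have hp : ∀ k, (Z ^ k) x = z ^ k • x := fun k => by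
    induction k with
    | zero => simp
    | succ k ih => rw [pow_succ', Module.End.mul_apply, ih, map_smul, hx, smul_smul, pow_succ]
  unfold ZD
  simp only [hp]
  rw [hB.zd, add_smul, one_smul, Finset.sum_smul]
  simp only [mul_smul]

theorem MD.ZD_E (h : MD d m a b z s D F S Z) (hd : 2 ≤ d) (k : ℕ) : ZD d b Z ((Z ^ k) (D 2)) := by
  induction k with
  | zero => rw [pow_zero]; exact h.Ed hd
  | succ k ih => rw [pow_succ', Module.End.mul_apply]; exact ih.Zapp

theorem MD.ZD_F (h : MD d m a b z s D F S Z) (hB : HR d m a b z s) (hd : 2 ≤ d) (k t : ℕ)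
    (hk1 : 1 ≤ k) (hk2 : k < d) (ht : t + 1 ≤ m) : ZD d b Z (F k (t+2)) := by
  set A := algebraMap R B a with hA
  have cA : ∀ x, A * x = x * A := fun x => Algebra.commutes a x
  set X := ∑ r ∈ Finset.range (k-1), (A * z ^ (r+1) * WW s t) • (Z ^ (k-1-r)) (D 2) with hX
  have hXZ : ZD d b Z X := ZD.sum _ fun r _ => (h.ZD_E hd _).smul _
  have key : Z X + A • (z ^ k * WW s t) • F 1 1 = z • X + A • (z * WW s t) • F k 1 := by
    have hf : ∀ q, ∑ r ∈ Finset.range q, (A * z ^ (r+1) * WW s t) • Z ((Z ^ (q-r)) (D 2)) +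
        (A * z ^ (q+1) * WW s t) • (Z ^ 1) (D 2) =
        ∑ r ∈ Finset.range q, (A * z ^ (r+1+1) * WW s t) • (Z ^ (q-r)) (D 2) +
        (A * z * WW s t) • (Z ^ (q+1)) (D 2) := by
      intro q
      have e1 : ∀ r ∈ Finset.range q, (A * z ^ (r+1) * WW s t) • Z ((Z ^ (q-r)) (D 2)) =
          (fun r => (A * z ^ (r+1) * WW s t) • ((Z ^ (q+1-r)) (D 2))) r := by
        intro r hr
        rw [Finset.mem_range] at hr
        simp only
        rw [← Module.End.mul_apply, ← pow_succ', show q - r + 1 = q + 1 - r by omega]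
      have e2 : ∀ r ∈ Finset.range q, (A * z ^ (r+1+1) * WW s t) • (Z ^ (q-r)) (D 2) =
          (fun r => (A * z ^ (r+1) * WW s t) • ((Z ^ (q+1-r)) (D 2))) (r+1) := by
        intro r hr
        simp only
        rw [show q + 1 - (r+1) = q - r by omega]
      rw [Finset.sum_congr rfl e1, Finset.sum_congr rfl e2]
      have := Finset.sum_range_succ (fun r => (A * z ^ (r+1) * WW s t) • ((Z ^ (q+1-r)) (D 2))) q
      rw [Finset.sum_range_succ'] at this
      simp only [Nat.add_sub_cancel_left, Nat.sub_zero, zero_add, pow_one] at this ⊢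
      exact this.symm
    have := hf (k-1)
    rw [show k - 1 + 1 = k by omega, h.Epow 1 le_rfl (by omega), h.Epow k hk1 hk2] at this
    rw [hX, map_sum, Finset.smul_sum]
    simp only [map_smul, smul_smul, ← mul_assoc]
    simp only [← cA, ← mul_assoc]
    convert this using 5 with r hr
    rw [pow_succ' z (r+1)]; simp only [mul_assoc]
  have hG : ZD d b Z (F k (t+2) + X) := by
    apply ZD.of_eig hB
    rw [map_add, h.zF k t hk1 hk2 ht, smul_add]
    have := eq_sub_of_add_eq key
    rw [this, ← hA]; abel
  have : F k (t+2) = (F k (t+2) + X) + (-1 : B) • X := by simp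
  rw [this]
  exact hG.add (hXZ.smul _)

end MDsec

section MDsec2
variable {R B M : Type*} [CommRing R] [Ring B] [Algebra R B] [AddCommGroup M] [Module B M]
  {d m : ℕ} {a : R} {b : ℕ → R} {z : B} {s : ℕ → B} {D : ℕ → M} {F : ℕ → ℕ → M}
  {S : ℕ → M →ₗ[B] M} {Z : M →ₗ[B] M}

theorem MD.S_E (h : MD d m a b z s D F S Z) (hd : 2 ≤ d) (j k : ℕ) (hj : 2 ≤ j) (hj2 : j ≤ m)
    (hk : k ≤ d) : S (j+1) ((Z ^ k) (D 2)) = s j • (Z ^ k) (D 2) := by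
  have h0 : S (j+1) (D 2) = s j • D 2 := h.Dps.hi 1 j le_rfl hj (by omega)
  have h1 : ∀ k, k < d → S (j+1) ((Z ^ k) (D 2)) = s j • (Z ^ k) (D 2) := by
    intro k hk
    rcases Nat.eq_zero_or_pos k with h' | h'
    · subst h'; simpa using h0
    · rw [h.Epow k h' hk]; exact (h.Fps k h' hk).hi 1 j le_rfl hj (by omega)
  rcases lt_or_eq_of_le hk with hk | hk
  · exact h1 k hk
  · subst hk
    rw [h.Ed hd, map_add, smul_add, h0, map_sum, Finset.smul_sum]
    congr 1
    refine Finset.sum_congr rfl fun i hi => ?_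
    rw [Finset.mem_Icc] at hi
    rw [map_smul, h1 _ (by omega), smul_smul, smul_smul, Algebra.commutes]

theorem MD.SZ_E (h : MD d m a b z s D F S Z) (hd : 2 ≤ d) (j k : ℕ) (hj : 2 ≤ j) (hj2 : j ≤ m)
    (hk : k < d) : S (j+1) (Z ((Z ^ k) (D 2))) = Z (S (j+1) ((Z ^ k) (D 2))) := by
  rw [h.S_E hd j k hj hj2 hk.le, map_smul, ← Module.End.mul_apply Z, ← pow_succ',
    h.S_E hd j (k+1) hj hj2 hk]

theorem MD.SZ_D (h : MD d m a b z s D F S Z) (hB : HR d m a b z s) (j i : ℕ) (hj : 2 ≤ j)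
    (hj2 : j ≤ m) (hi : 3 ≤ i) (hi2 : i ≤ m + 2) : S (j+1) (Z (D i)) = Z (S (j+1) (D i)) := by
  obtain ⟨i, rfl⟩ : ∃ i', i = i' + 1 := ⟨i - 1, by omega⟩
  rw [h.zD _ hi hi2, map_smul]
  rcases lt_trichotomy i j with hij | hij | hij
  · rw [h.Dps.hi i j (by omega) hij (by omega), map_smul, h.zD _ hi hi2, smul_smul, smul_smul,
      hB.zs j (by omega) (by omega)]
  · subst hij
    rw [h.Dps.up i (by omega) (by omega), map_add, map_smul, h.zD _ hi hi2,
      h.zD _ (by omega) (by omega), smul_add, smul_smul, smul_smul, Algebra.commutes]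
  · rcases eq_or_lt_of_le (Nat.succ_le_of_lt hij) with hij | hij
    · subst hij
      rw [h.Dps.dn j (by omega) (by omega), map_add, zero_smul, zero_add, map_zero, zero_add,
        h.zD _ (by omega) (by omega)]
    · rw [h.Dps.lo i (j+1) (by omega) hij (by omega), map_smul, h.zD _ hi hi2, smul_smul, smul_smul,
        hB.zs (j+1) (by omega) (by omega)]

theorem HR.zpow_s (hB : HR d m a b z s) (j : ℕ) (hj : 3 ≤ j) (hj2 : j ≤ m) (k : ℕ) :
    z ^ k * s j = s j * z ^ k :=
  (show Commute z (s j) from hB.zs j hj hj2).pow_left k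

theorem MD.SZ_F (h : MD d m a b z s D F S Z) (hB : HR d m a b z s) (hd : 2 ≤ d) (j k t : ℕ)
    (hj : 2 ≤ j) (hj2 : j ≤ m) (hk1 : 1 ≤ k) (hk2 : k < d) (ht : t + 1 ≤ m) :
    S (j+1) (Z (F k (t+2))) = Z (S (j+1) (F k (t+2))) := by
  have e1 : S (j+1) (F 1 1) = s j • F 1 1 := (h.Fps 1 le_rfl (by omega)).hi 1 j le_rfl hj (by omega)
  have ek : S (j+1) (F k 1) = s j • F k 1 := (h.Fps k hk1 hk2).hi 1 j le_rfl hj (by omega)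
  have cA : ∀ x, x * algebraMap R B a = algebraMap R B a * x := fun x => (Algebra.commutes a x).symm
  have cA' : ∀ x y, x * (algebraMap R B a * y) = algebraMap R B a * (x * y) := fun x y => by
    rw [← mul_assoc, cA, mul_assoc]
  have hP := h.Fps k hk1 hk2
  rw [h.zF k t hk1 hk2 ht, map_sub, map_add, map_smul, map_smul, map_smul, map_smul, map_smul, e1, ek]
  rcases lt_trichotomy (t+2) j with hij | hij | hij
  · rw [hP.hi (t+2) j (by omega) hij (by omega), map_smul, h.zF k t hk1 hk2 ht]
    simp only [smul_smul, smul_add, smul_sub, cA', mul_assoc]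
    rw [hB.W_comm t j (by omega) (by omega), ← mul_assoc (z ^ k), hB.zpow_s j (by omega) hj2,
      ← mul_assoc z (s j), hB.zs j (by omega) hj2]
    simp only [mul_assoc]
  · subst hij
    rw [hP.up (t+2) (by omega) (by omega), zero_smul, zero_add, h.zF k (t+1) hk1 hk2 (by omega)]
    simp only [smul_smul, WW, mul_assoc]
  · rcases eq_or_lt_of_le (Nat.succ_le_of_lt hij) with hij | hij
    · obtain ⟨t, rfl⟩ : ∃ t', t = t' + 1 := ⟨t - 1, by omega⟩
      obtain rfl : j = t + 2 := by omega
      have := hP.dn (t+2) (by omega) (by omega)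
      rw [show t + 1 + 2 = t + 2 + 1 by omega, this]
      have hz := h.zF k (t+1) hk1 hk2 ht
      rw [show t + 1 + 2 = t + 2 + 1 by omega] at hz
      rw [map_add, map_smul, hz, h.zF k t hk1 hk2 (by omega)]
      have hw : WW s (t+1) * s (t+2) = algebraMap R B a * WW s (t+1) + WW s t := by
        rw [WW, mul_assoc, hB.sq (t+2) (by omega) (by omega), mul_add, mul_one, cA']
      simp only [smul_smul, smul_add, smul_sub, mul_assoc, hw, mul_add, cA, cA', add_smul]
      abel
    · have := hP.lo (t+2) (j+1) (by omega) (by omega) (by omega)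
      rw [this, map_smul, h.zF k t hk1 hk2 ht]
      simp only [smul_smul, smul_add, smul_sub, cA', mul_assoc]
      rw [hB.W_lo t j (by omega) (by omega) (by omega), ← mul_assoc (z ^ k),
        hB.zpow_s (j+1) (by omega) (by omega), ← mul_assoc z (s (j+1)),
        hB.zs (j+1) (by omega) (by omega)]
      simp only [mul_assoc]

theorem MD.starE (h : MD d m a b z s D F S Z) (hB : HR d m a b z s) (hd : 2 ≤ d) (hm : 1 ≤ m) (k : ℕ) (hk : k ≤ d) :
    Z (S 2 ((Z ^ k) (D 2))) = z • S 2 ((Z ^ k) (D 2)) + algebraMap R B a • z ^ k • F 1 1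
      - algebraMap R B a • z • (Z ^ k) (D 2) := by
  have h0 : S 2 (D 2) = algebraMap R B a • D 2 + D 3 := h.Dps.up 1 le_rfl (by omega)
  have cA : ∀ (r : R) x, x * algebraMap R B r = algebraMap R B r * x :=
    fun r x => (Algebra.commutes r x).symm
  have hz0 : Z (S 2 (D 2)) = z • S 2 (D 2) + algebraMap R B a • F 1 1
      - algebraMap R B a • z • D 2 := by
    rw [h0, map_add, map_smul, h.zE0, h.zD 3 le_rfl (by omega)]
    simp only [smul_add, smul_smul, cA]; abel
  have h1 : ∀ k, 1 ≤ k → k < d → Z (S 2 ((Z ^ k) (D 2))) = z • S 2 ((Z ^ k) (D 2)) +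
      algebraMap R B a • z ^ k • F 1 1 - algebraMap R B a • z • (Z ^ k) (D 2) := by
    intro k hk1 hk2
    have h3 : S 2 (F k 1) = F k 2 := by
      have := (h.Fps k hk1 hk2).up 1 le_rfl (by omega)
      rwa [zero_smul, zero_add] at this
    have := h.zF k 0 hk1 hk2 (by omega)
    rw [h.Epow k hk1 hk2, h3, this, WW, mul_one, mul_one]
  rcases lt_or_eq_of_le hk with hk | hk
  · rcases Nat.eq_zero_or_pos k with h' | h'
    · subst h'; simpa using hz0
    · exact h1 k h' hk
  · subst hk
    rw [hB.zd]
    rw [h.Ed hd]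
    simp only [map_add, map_sum, map_smul, hz0]
    rw [Finset.sum_congr rfl (g := fun i => z • (algebraMap R B (b i) • S 2 ((Z ^ (k-i)) (D 2))) +
      algebraMap R B a • (algebraMap R B (b i) * z ^ (k-i)) • F 1 1
        - algebraMap R B a • z • (algebraMap R B (b i) • (Z ^ (k-i)) (D 2)))
      (fun i hi => by
        rw [Finset.mem_Icc] at hi; rw [h1 _ (by omega) (by omega)]
        simp only [smul_add, smul_sub, smul_smul]
        simp only [← mul_assoc]
        rw [cA (b i) (_ * z), cA (b i) z, ← mul_assoc, cA (b i) (algebraMap R B a)])]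
    rw [Finset.sum_sub_distrib, Finset.sum_add_distrib]
    simp only [← Finset.smul_sum, ← Finset.sum_smul, smul_add, add_smul, one_smul]
    abel

/-- The braid relation of length four on vectors. -/
def Q4 (S : ℕ → M →ₗ[B] M) (Z : M →ₗ[B] M) (x : M) : Prop :=
  S 2 (Z (S 2 (Z x))) = Z (S 2 (Z (S 2 x)))

theorem Q4.add {x y : M} (hx : Q4 S Z x) (hy : Q4 S Z y) : Q4 S Z (x + y) := by
  unfold Q4 at *; simp only [map_add, hx, hy]

theorem Q4.smul {x : M} (c : B) (hx : Q4 S Z x) : Q4 S Z (c • x) := by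
  unfold Q4 at *; simp only [map_smul, hx]

theorem Q4.app {x : M} {A : B} (hS : ∀ y, S 2 (S 2 y) = A • S 2 y + y) (hx : Q4 S Z x) :
    Q4 S Z (S 2 x) := by
  unfold Q4 at *
  rw [← hx, hS, hS, map_add, map_add, map_add, map_smul, map_smul, map_smul, hx]

theorem MD.Q4_E (h : MD d m a b z s D F S Z) (hB : HR d m a b z s) (hd : 2 ≤ d) (hm : 1 ≤ m)
    (hS : ∀ y, S 2 (S 2 y) = algebraMap R B a • S 2 y + y) (k : ℕ) (hk : k < d) :
    Q4 S Z ((Z ^ k) (D 2)) := by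
  have cA : ∀ x, x * algebraMap R B a = algebraMap R B a * x := fun x => (Algebra.commutes a x).symm
  have cA' : ∀ x y, x * (algebraMap R B a * y) = algebraMap R B a * (x * y) := fun x y => by
    rw [← mul_assoc, cA, mul_assoc]
  have e1 : Z ((Z ^ k) (D 2)) = (Z ^ (k+1)) (D 2) := by rw [pow_succ', Module.End.mul_apply]
  have hk0 := h.starE hB hd hm k hk.le
  have hk1 := h.starE hB hd hm (k+1) hk
  have h1 := h.starE hB hd hm 1 (by omega)
  rw [h.Epow 1 le_rfl (by omega), pow_one] at h1
  unfold Q4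
  rw [e1, hk0, hk1]
  simp only [map_add, map_sub, map_smul, hS, hk0, hk1, h1, e1]
  simp only [smul_add, smul_sub, smul_smul, cA, cA', pow_succ z k, mul_assoc]
  abel

theorem MD.Q4_D (h : MD d m a b z s D F S Z) (hB : HR d m a b z s) (hd : 2 ≤ d) (hm : 1 ≤ m)
    (hS : ∀ y, S 2 (S 2 y) = algebraMap R B a • S 2 y + y) (i : ℕ) (hi : 2 ≤ i) (hi2 : i ≤ m + 2) :
    Q4 S Z (D i) := by
  have h2 : Q4 S Z (D 2) := by
    simpa only [pow_zero, Module.End.one_apply] using h.Q4_E hB hd hm hS 0 (by omega)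
  by_cases hc2 : i = 2
  · subst hc2; exact h2
  by_cases hc3 : i = 3
  · subst hc3
    have h0 : S 2 (D 2) = algebraMap R B a • D 2 + D 3 := h.Dps.up 1 le_rfl (by omega)
    have : D 3 = S 2 (D 2) + (-algebraMap R B a) • D 2 := by rw [h0, neg_smul]; abel
    rw [this]
    exact (h2.app hS).add (h2.smul _)
  · obtain ⟨i, rfl⟩ : ∃ i', i = i' + 1 := ⟨i - 1, by omega⟩
    have hs := h.Dps.lo i 2 le_rfl (by omega) (by omega)
    have hz := h.zD (i+1) (by omega) hi2
    unfold Q4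
    simp only [hs, hz, map_smul, smul_smul]
    rw [hB.zszs (by omega)]

theorem MD.Q4_F (h : MD d m a b z s D F S Z) (hB : HR d m a b z s) (hd : 2 ≤ d) (hm : 1 ≤ m)
    (hS : ∀ y, S 2 (S 2 y) = algebraMap R B a • S 2 y + y) (k i : ℕ) (hk1 : 1 ≤ k) (hk2 : k < d)
    (hi : 1 ≤ i) (hi2 : i ≤ m + 1) :
    Q4 S Z (F k i) := by
  by_cases hc1 : i = 1
  · subst hc1
    rw [← h.Epow k hk1 hk2]; exact h.Q4_E hB hd hm hS k hk2
  by_cases hc2 : i = 2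
  · subst hc2
    have h3 : S 2 (F k 1) = F k 2 := by
      have := (h.Fps k hk1 hk2).up 1 le_rfl (by omega)
      rwa [zero_smul, zero_add] at this
    rw [← h3, ← h.Epow k hk1 hk2]; exact (h.Q4_E hB hd hm hS k hk2).app hS
  obtain ⟨t, rfl⟩ : ∃ t, i = t + 1 + 2 := ⟨i - 3, by omega⟩
  have hs := (h.Fps k hk1 hk2).lo (t+1+2) 2 le_rfl (by omega) hi2
  have hz := h.zF k (t+1) hk1 hk2 (by omega)
  have hEk := h.starE hB hd hm k hk2.le
  have hE1 := h.starE hB hd hm 1 (by omega)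
  rw [h.Epow 1 le_rfl (by omega)] at hE1
  rw [h.Epow k hk1 hk2] at hEk
  obtain ⟨w, hw, hwz⟩ := hB.W_split t (by omega)
  have hwzk : w * z ^ k = z ^ k * w := (show Commute w z from hwz).pow_right k
  have hm2 : 2 ≤ m := by omega
  have r1 := hB.zszs hm2
  have r2 := hB.sq' 2 le_rfl hm2
  have r3 := hB.star hm2 k
  have r4 := hB.t_comm hm2
  have r1w : z * (s 2 * (z * (s 2 * w))) = s 2 * (z * (s 2 * (z * w))) := by
    have := congrArg (· * w) r1
    simpa only [mul_assoc] using this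
  have r3w : s 2 * (z ^ k * (s 2 * (z * w))) = z * (s 2 * (z ^ k * (s 2 * w))) +
      a • (z ^ k * (s 2 * (z * w))) - a • (z * (s 2 * (z ^ k * w))) := by
    have := congrArg (· * w) r3
    simpa only [mul_assoc, add_mul, sub_mul, smul_mul_assoc] using this
  have r5 : ∀ k, s 2 * (z * (s 2 * (z ^ k * (s 2 * w)))) =
      a • (s 2 * (z * (s 2 * (z ^ k * w)))) + z ^ k * (s 2 * (z * w)) := by
    intro k
    have e := r4 k
    have e2 : s 2 * (z * (s 2 * (z ^ k * w))) = z ^ k * (s 2 * (z * (s 2 * w))) := by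
      have := congrArg (· * w) e
      simpa only [mul_assoc] using this
    have e3 : s 2 * (z * (s 2 * (z ^ k * (s 2 * w)))) = z ^ k * (s 2 * (z * ((s 2 * s 2) * w))) := by
      have := congrArg (· * (s 2 * w)) e
      simpa only [mul_assoc] using this
    rw [e3, e2, r2]
    simp only [mul_add, add_mul, smul_mul_assoc, mul_smul_comm, one_mul]
  have r5w := r5 k
  have r6w := r5 1
  rw [pow_one] at r6w
  unfold Q4
  simp only [hs, hz, hw, map_add, map_sub, map_smul, hS, hEk, hE1, smul_add, smul_sub]
  match_scalars
  all_goals simp only [Algebra.algebraMap_eq_smul_one, smul_mul_assoc, mul_smul_comm, one_mul,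
    mul_one, mul_add, mul_sub, add_mul, sub_mul, zero_add, pow_one, smul_smul]
  · simpa only [mul_assoc] using r1
  · simp only [mul_assoc, hwz, hwzk, r3w, smul_add, smul_sub]; module
  · simp only [mul_assoc, hwz, hwzk, r1w]; module
  · simp only [mul_assoc, hwz, hwzk, r5w, smul_add]; module
  · simp only [mul_assoc, hwz, hwzk, r6w, smul_add]; module
end MDsec2

section ToHR
open MulOpposite
variable {R B M : Type*} [CommRing R] [Ring B] [Algebra R B] [AddCommGroup M] [Module B M]
  [Module R M] [IsScalarTower R B M]
  {d m : ℕ} {a : R} {b : ℕ → R} {z : B} {s : ℕ → B} {D : ℕ → M} {F : ℕ → ℕ → M}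
  {S : ℕ → M →ₗ[B] M} {Z : M →ₗ[B] M}

theorem MD.toHR (h : MD d m a b z s D F S Z) (hB : HR d m a b z s) (hd : 2 ≤ d) (hm : 1 ≤ m)
    (ext : ∀ f g : M →ₗ[B] M, (∀ i, 2 ≤ i → i ≤ m + 2 → f (D i) = g (D i)) →
      (∀ k i, 1 ≤ k → k < d → 1 ≤ i → i ≤ m + 1 → f (F k i) = g (F k i)) → f = g) :
    HR (A := (Module.End B M)ᵐᵒᵖ) d (m+1) a b (op (Z : Module.End B M))
      (fun j => op (S j : Module.End B M)) := by
  have cA : ∀ x, algebraMap R B a * x = x * algebraMap R B a := Algebra.commutes a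
  have c0 : ∀ x : B, 0 * x = x * 0 := by simp
  have hDi : ∀ i, 2 ≤ i → i ≤ m + 2 → ∃ i', i = i' + 1 ∧ 1 ≤ i' ∧ i' ≤ m + 1 := fun i h1 h2 =>
    ⟨i - 1, by omega, by omega, by omega⟩
  have hsm : ∀ (r : R) (x : M), r • x = algebraMap R B r • x := fun r x =>
    (algebraMap_smul B r x).symm
  have hsq : ∀ j, 2 ≤ j → j ≤ m + 1 → ∀ y, S j (S j y) = algebraMap R B a • S j y + y := by
    intro j hj1 hj2
    have : S j ∘ₗ S j = a • S j + LinearMap.id := by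
      apply ext
      · intro i h1 h2
        obtain ⟨i, rfl, h1, h2⟩ := hDi i h1 h2
        have := h.Dps.sq hB (add_zero _) (mul_zero _) (zero_mul _) i j h1 h2 hj1 hj2
        simpa using this
      · intro k i h1 h2 h3 h4
        have := (h.Fps k h1 h2).sq hB (zero_add _) (zero_mul _) (mul_zero _) i j h3 h4 hj1 hj2
        simpa using this
    intro y
    have := LinearMap.congr_fun this y
    simpa using this
  refine ⟨fun _ => ?_, fun j hj1 hj2 => ?_, fun j hj1 hj2 => ?_, fun j k hj1 hj2 hjk => ?_, ?_,
    fun j hj1 hj2 => ?_⟩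
  · apply unop_injective
    simp only [unop_mul, unop_op]
    apply ext
    · intro i h1 h2
      exact h.Q4_D hB hd hm (hsq 2 le_rfl (by omega)) i h1 h2
    · intro k i h1 h2 h3 h4
      exact h.Q4_F hB hd hm (hsq 2 le_rfl (by omega)) k i h1 h2 h3 h4
  · apply unop_injective
    obtain ⟨j, rfl⟩ : ∃ j', j = j' + 1 := ⟨j - 1, by omega⟩
    simp only [unop_mul, unop_op]
    apply ext
    · intro i h1 h2
      simp only [Module.End.mul_apply]
      rcases eq_or_lt_of_le h1 with h1 | h1
      · subst h1
        simpa using h.SZ_E hd j 0 (by omega) (by omega) (by omega)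
      · exact h.SZ_D hB j i (by omega) (by omega) h1 h2
    · intro k i h1 h2 h3 h4
      simp only [Module.End.mul_apply]
      rcases eq_or_lt_of_le h3 with h3 | h3
      · subst h3
        rw [← h.Epow k h1 h2]
        exact h.SZ_E hd j k (by omega) (by omega) (by omega)
      · obtain ⟨i, rfl⟩ : ∃ i', i = i' + 2 := ⟨i - 2, by omega⟩
        exact h.SZ_F hB hd j k i (by omega) (by omega) h1 h2 (by omega)
  · apply unop_injective
    simp only [unop_mul, unop_op, ← mul_assoc]
    apply ext
    · intro i h1 h2
      obtain ⟨i, rfl, h1, h2⟩ := hDi i h1 h2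
      exact h.Dps.braid hB cA c0 (add_zero _) (mul_zero _) i j h1 h2 hj1 hj2
    · intro k i h1 h2 h3 h4
      exact (h.Fps k h1 h2).braid hB c0 cA (zero_add _) (zero_mul _) i j h3 h4 hj1 hj2
  · apply unop_injective
    simp only [unop_mul, unop_op]
    apply ext
    · intro i h1 h2
      obtain ⟨i, rfl, h1, h2⟩ := hDi i h1 h2
      exact (h.Dps.comm hB cA c0 i j k h1 h2 hj1 hj2 hjk).symm
    · intro l i h1 h2 h3 h4
      exact ((h.Fps l h1 h2).comm hB c0 cA i j k h3 h4 hj1 hj2 hjk).symm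
  · apply unop_injective
    have key : (Z : Module.End B M) ^ d = (∑ i ∈ Finset.Icc 1 (d-1), b i • (Z : Module.End B M) ^ (d-i)) + 1 := by
      apply ext
      · intro i h1 h2
        have : ZD d b Z (D i) := by
          rcases eq_or_lt_of_le h1 with h1 | h1
          · subst h1; simpa using h.ZD_E hd 0
          · exact ZD.of_eig hB (h.zD i h1 h2)
        unfold ZD at this
        rw [this]
        simp [LinearMap.add_apply, LinearMap.sum_apply]
      · intro k i h1 h2 h3 h4
        have : ZD d b Z (F k i) := by
          rcases eq_or_lt_of_le h3 with h3 | h3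
          · subst h3; rw [← h.Epow k h1 h2]; exact h.ZD_E hd k
          · obtain ⟨i, rfl⟩ : ∃ i', i = i' + 2 := ⟨i - 2, by omega⟩
            exact h.ZD_F hB hd k i h1 h2 (by omega)
        unfold ZD at this
        rw [this]
        simp [LinearMap.add_apply, LinearMap.sum_apply]
    simp only [← Algebra.smul_def]
    rw [unop_add, unop_pow, unop_op, key, unop_one, Finset.unop_sum]
    simp
  · apply unop_injective
    simp only [← Algebra.smul_def]
    ext y
    simpa using hsq j hj1 hj2 y
end ToHR

section Span
variable {R A : Type*} [CommRing R] [Ring A] [Algebra R A]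
  {d m : ℕ} {a : R} {b : ℕ → R} {z : A} {s : ℕ → A}

/-- `DL s n i = s_n ⋯ s_i`. -/
def DL (s : ℕ → A) (n i : ℕ) : A := (((List.range' i (n + 1 - i)).reverse).map s).prod

theorem DL_top (s : ℕ → A) (n : ℕ) : DL s n (n+1) = 1 := by simp [DL]

theorem DL_succ (s : ℕ → A) (n i : ℕ) (h : i ≤ n) : DL s n i = DL s n (i+1) * s i := by
  unfold DL
  rw [show n + 1 - i = (n + 1 - (i+1)) + 1 by omega, List.range'_succ]
  simp

theorem WW_eq (s : ℕ → A) (t : ℕ) : ((List.range' 2 (t + 1 + 1 - 2)).map s).prod = WW s t := by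
  induction t with
  | zero => simp [WW]
  | succ t ih =>
    rw [show t + 1 + 1 + 1 - 2 = (t + 1 + 1 - 2) + 1 by omega, List.range'_concat]
    rw [List.map_append, List.prod_append, ih, WW]
    have e : 2 + 1 * (t + 1 + 1 - 2) = t + 2 := by omega
    simp only [List.map_cons, List.map_nil, List.prod_cons, List.prod_nil, mul_one, e]

theorem HR.DL_comm (h : HR d (m+1) a b z s) (x : A) (i0 : ℕ)
    (hx : ∀ j, i0 ≤ j → j ≤ m + 1 → s j * x = x * s j) (i : ℕ) (hi : i0 ≤ i) (hi2 : i ≤ m + 2) :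
    DL s (m+1) i * x = x * DL s (m+1) i := by
  obtain ⟨t, ht⟩ : ∃ t, i + t = m + 2 := ⟨m + 2 - i, by omega⟩
  induction t generalizing i with
  | zero => obtain rfl : i = m + 1 + 1 := by omega
            rw [DL_top]; simp
  | succ t ih =>
    rw [DL_succ _ _ _ (by omega), mul_assoc, hx i hi (by omega), ← mul_assoc,
      ih (i+1) (by omega) (by omega) (by omega), mul_assoc]

theorem HR.DL_lo (h : HR d (m+1) a b z s) (i j : ℕ) (hj : 2 ≤ j) (hi : j + 2 ≤ i) (hi2 : i ≤ m + 2) :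
    DL s (m+1) i * s j = s j * DL s (m+1) i :=
  h.DL_comm (s j) (j+2) (fun k h1 h2 => (h.comm j k hj h2 (by omega)).symm) i hi hi2

theorem HR.DL_z (h : HR d (m+1) a b z s) (i : ℕ) (hi : 3 ≤ i) (hi2 : i ≤ m + 2) :
    DL s (m+1) i * z = z * DL s (m+1) i :=
  h.DL_comm z 3 (fun k h1 h2 => (h.zs k h1 h2).symm) i hi hi2

theorem HR.DL_hi (h : HR d (m+1) a b z s) (i j : ℕ) (hi : 2 ≤ i) (hij : i ≤ j) (hj : j ≤ m) :
    DL s (m+1) i * s (j+1) = s j * DL s (m+1) i := by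
  obtain ⟨t, ht⟩ : ∃ t, i + t = j := ⟨j - i, by omega⟩
  induction t generalizing i with
  | zero =>
    obtain rfl : i = j := by omega
    rw [DL_succ _ _ i (by omega), DL_succ _ _ (i+1) (by omega), mul_assoc, mul_assoc, ← mul_assoc (s (i+1)),
      ← h.braid i (by omega) (by omega), mul_assoc, ← mul_assoc (DL s (m+1) (i+1+1)),
      h.DL_lo (i+1+1) i (by omega) (by omega) (by omega)]
    simp only [mul_assoc]
  | succ t ih =>
    rw [DL_succ _ _ i (by omega), mul_assoc, h.comm i (j+1) (by omega) (by omega) (by omega),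
      ← mul_assoc, ih (i+1) (by omega) (by omega) (by omega), mul_assoc]

theorem HR.W_split2 (h : HR d (m+1) a b z s) (t : ℕ) (h2 : t + 1 ≤ m) :
    ∃ w, WW s (t+1) = s 2 * w ∧ w * z = z * w ∧ DL s (m+1) 2 * w = WW s t * DL s (m+1) 2 := by
  induction t with
  | zero => exact ⟨1, by simp [WW], by simp, by simp [WW]⟩
  | succ t ih =>
    obtain ⟨w, h1, h3, h4⟩ := ih (by omega)
    refine ⟨w * s (t+3), ?_, ?_, ?_⟩
    · rw [WW, h1, mul_assoc]
    · rw [mul_assoc, ← h.zs (t+3) (by omega) (by omega), ← mul_assoc, h3, mul_assoc]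
    · rw [← mul_assoc, h4, mul_assoc, h.DL_hi 2 (t+2) (by omega) (by omega) (by omega), WW, mul_assoc]

/-- Closure hypotheses for the spanning argument. -/
structure SP (d m : ℕ) (z : A) (s : ℕ → A) (N : Submodule R A) : Prop where
  hz : ∀ x ∈ N, z * x ∈ N
  hs : ∀ j, 2 ≤ j → j ≤ m → ∀ x ∈ N, s j * x ∈ N
  hD : ∀ i, 2 ≤ i → i ≤ m + 2 → DL s (m+1) i ∈ N
  hF : ∀ k t, 1 ≤ k → k < d → t ≤ m → DL s (m+1) 2 * z ^ k * WW s t ∈ N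

theorem SP.hW {N : Submodule R A} (hN : SP d m z s N) (t : ℕ) (ht : t + 1 ≤ m) (x : A) (hx : x ∈ N) :
    WW s t * x ∈ N := by
  induction t generalizing x with
  | zero => simpa [WW]
  | succ t ih =>
    rw [WW, mul_assoc]
    exact ih (by omega) _ (hN.hs _ (by omega) (by omega) _ hx)

theorem SP.hzk {N : Submodule R A} (hN : SP d m z s N) (k : ℕ) (x : A) (hx : x ∈ N) :
    z ^ k * x ∈ N := by
  induction k generalizing x with
  | zero => simpa
  | succ k ih =>
    rw [pow_succ, mul_assoc]
    exact ih _ (hN.hz _ hx)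

theorem SP.D_s {N : Submodule R A} (hN : SP d m z s N) (h : HR d (m+1) a b z s) (i j : ℕ)
    (hi : 2 ≤ i) (hi2 : i ≤ m + 2) (hj : 2 ≤ j) (hj2 : j ≤ m + 1) : DL s (m+1) i * s j ∈ N := by
  by_cases h1 : j + 2 ≤ i
  · rw [h.DL_lo i j hj h1 hi2]; exact hN.hs j hj (by omega) _ (hN.hD i hi hi2)
  by_cases h2 : i = j + 1
  · subst h2; rw [← DL_succ _ _ _ hj2]; exact hN.hD j hj (by omega)
  by_cases h3 : i = j
  · subst h3; rw [DL_succ _ _ _ hj2, mul_assoc, h.sq' i hj hj2, mul_add, mul_one, mul_smul_comm,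
      ← DL_succ _ _ _ hj2]
    exact N.add_mem (N.smul_mem _ (hN.hD i hj (by omega))) (hN.hD (i+1) (by omega) (by omega))
  · obtain ⟨j, rfl⟩ : ∃ j', j = j' + 1 := ⟨j - 1, by omega⟩
    rw [h.DL_hi i j hi (by omega) (by omega)]
    exact hN.hs j (by omega) (by omega) _ (hN.hD i hi hi2)

theorem SP.D_z {N : Submodule R A} (hN : SP d m z s N) (h : HR d (m+1) a b z s) (hd : 2 ≤ d) (i : ℕ)
    (hi : 2 ≤ i) (hi2 : i ≤ m + 2) : DL s (m+1) i * z ∈ N := by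
  rcases eq_or_lt_of_le hi with h1 | h1
  · subst h1; simpa [WW] using hN.hF 1 0 le_rfl (by omega) (by omega)
  · rw [h.DL_z i h1 hi2]; exact hN.hz _ (hN.hD i hi hi2)

theorem SP.F_s {N : Submodule R A} (hN : SP d m z s N) (h : HR d (m+1) a b z s) (k t j : ℕ)
    (hk : 1 ≤ k) (hk2 : k < d) (ht : t ≤ m) (hj : 2 ≤ j) (hj2 : j ≤ m + 1) :
    DL s (m+1) 2 * z ^ k * WW s t * s j ∈ N := by
  have hp : ∀ j, 2 ≤ j → j ≤ m → DL s (m+1) 2 * z ^ k * (s (j+1) * WW s t) ∈ N := by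
    intro j h1 h2
    have : DL s (m+1) 2 * z ^ k * (s (j+1) * WW s t) = s j * (DL s (m+1) 2 * z ^ k * WW s t) := by
      have e := h.zpow_s (j+1) (by omega) (by omega) k
      rw [mul_assoc, ← mul_assoc (z^k), e, mul_assoc, ← mul_assoc, h.DL_hi 2 j le_rfl h1 h2]
      simp only [mul_assoc]
    rw [this]
    exact hN.hs j h1 h2 _ (hN.hF k t hk hk2 ht)
  by_cases h1 : j = t + 2
  · subst h1; rw [mul_assoc]; exact hN.hF k (t+1) hk hk2 (by omega)
  by_cases h2 : j = t + 1
  · obtain ⟨t, rfl⟩ : ∃ t', t = t' + 1 := ⟨t - 1, by omega⟩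
    subst h2
    have := h.sq' (t+2) (by omega) (by omega)
    have e : DL s (m+1) 2 * z ^ k * WW s (t+1) * s (t+1+1) =
      a • (DL s (m+1) 2 * z ^ k * WW s (t+1)) + DL s (m+1) 2 * z ^ k * WW s t := by
      rw [mul_assoc, WW, mul_assoc (WW s t), this, mul_add, mul_add, mul_one, mul_smul_comm, mul_smul_comm]
    rw [e]
    exact N.add_mem (N.smul_mem _ (hN.hF k _ hk hk2 (by omega))) (hN.hF k _ hk hk2 (by omega))
  by_cases h3 : j ≤ t
  · rw [mul_assoc, h.W_lo t j hj h3 (by omega)]; exact hp j hj (by omega)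
  · obtain ⟨j, rfl⟩ : ∃ j', j = j' + 1 := ⟨j - 1, by omega⟩
    rw [mul_assoc, h.W_comm t (j+1) (by omega) (by omega)]; exact hp j (by omega) (by omega)

theorem SP.F_z {N : Submodule R A} (hN : SP d m z s N) (h : HR d (m+1) a b z s) (hd : 2 ≤ d) (k t : ℕ)
    (hk : 1 ≤ k) (hk2 : k < d) (ht : t ≤ m) : DL s (m+1) 2 * z ^ k * WW s t * z ∈ N := by
  have hE : ∀ k, 1 ≤ k → k < d → DL s (m+1) 2 * z ^ k ∈ N := fun k h1 h2 => by
    simpa [WW] using hN.hF k 0 h1 h2 (by omega)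
  rcases Nat.eq_zero_or_pos t with h0 | h0
  · subst h0
    rw [WW, mul_one, mul_assoc, ← pow_succ]
    rcases eq_or_lt_of_le (Nat.succ_le_of_lt hk2) with h1 | h1
    · rw [Nat.succ_eq_add_one] at h1
      rw [h1, h.zd, mul_add, mul_one, Finset.mul_sum]
      refine N.add_mem (N.sum_mem fun i hi => ?_) (hN.hD 2 le_rfl (by omega))
      rw [Finset.mem_Icc] at hi
      rw [← Algebra.smul_def, mul_smul_comm]
      exact N.smul_mem _ (hE _ (by omega) (by omega))
    · exact hE _ (by omega) h1
  · obtain ⟨t, rfl⟩ : ∃ t', t = t' + 1 := ⟨t - 1, by omega⟩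
    obtain ⟨w, h1, h2, h3⟩ := h.W_split2 t ht
    have hwk : ∀ k, w * z ^ k = z ^ k * w := fun k => (show Commute w z from h2).pow_right k
    have h2' := DL_succ s (m+1) 2 (by omega)
    have e3 := h.DL_z 3 le_rfl (by omega)
    have e3k : ∀ k, DL s (m+1) 3 * z ^ k = z ^ k * DL s (m+1) 3 := fun k =>
      (show Commute (DL s (m+1) 3) z from e3).pow_right k
    have e4 : ∀ k, DL s (m+1) 3 * s 2 * (z ^ k * w) = WW s t * (DL s (m+1) 2 * z ^ k) := fun k => by
      rw [← hwk, ← h2', ← mul_assoc, h3, mul_assoc]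
    have st := h.star (by omega) k
    have : DL s (m+1) 2 * z ^ k * WW s (t+1) * z = z * (DL s (m+1) 2 * z ^ k * WW s (t+1))
        + a • (z ^ k * (WW s t * (DL s (m+1) 2 * z ^ 1)))
        - a • (z * (WW s t * (DL s (m+1) 2 * z ^ k))) := by
      rw [← e4, ← e4, h1, h2', pow_one]
      calc DL s (m+1) (2+1) * s 2 * z ^ k * (s 2 * w) * z
          = DL s (m+1) 3 * (s 2 * z ^ k * s 2 * z) * w := by
            simp only [mul_assoc]; rw [h2]
        _ = (DL s (m+1) 3 * z) * (s 2 * z ^ k * s 2 * w) + a • ((DL s (m+1) 3 * z ^ k) * (s 2 * z * w))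
            - a • ((DL s (m+1) 3 * z) * (s 2 * z ^ k * w)) := by
            rw [st]
            simp only [mul_add, add_mul, mul_sub, sub_mul, mul_smul_comm, smul_mul_assoc, mul_assoc]
        _ = _ := by
            rw [e3, e3k]
            simp only [mul_assoc]
    rw [this]
    refine N.sub_mem (N.add_mem (hN.hz _ (hN.hF k _ hk hk2 ht)) (N.smul_mem _ ?_)) (N.smul_mem _ ?_)
    · exact hN.hzk _ _ (hN.hW t ht _ (hE 1 le_rfl (by omega)))
    · exact hN.hz _ (hN.hW t ht _ (hE k hk hk2))
end Span

section HeckeBasics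

theorem sH_eq (d n j : ℕ) (h2 : 2 ≤ j) (hn : j ≤ n) :
    sH d n j = RingQuot.mkAlgHom (R0 d) (HRel d n) (FreeAlgebra.ι (R0 d) (HGen.s j h2 hn)) := by
  unfold sH
  rw [dif_pos ⟨h2, hn⟩]

theorem hecke_HR (d n : ℕ) : HR d n (aV d) (bV d) (zH d n) (sH d n) := by
  refine ⟨fun h => ?_, fun j h1 h2 => ?_, fun i h1 h2 => ?_, fun i j h1 h2 h3 => ?_, ?_,
    fun j h1 h2 => ?_⟩
  · have := RingQuot.mkAlgHom_rel (R0 d) (HRel.zszs (d := d) h)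
    rw [sH_eq d n 2 le_rfl h]
    simpa only [zH, map_mul] using this
  · have := RingQuot.mkAlgHom_rel (R0 d) (HRel.zs (d := d) j (by omega) h1 h2)
    rw [sH_eq d n j (by omega) h2]
    simpa only [zH, map_mul] using this
  · have := RingQuot.mkAlgHom_rel (R0 d) (HRel.braid (d := d) i h1 (by omega) (by omega) h2)
    rw [sH_eq d n i h1 (by omega), sH_eq d n (i+1) (by omega) h2]
    simpa only [zH, map_mul] using this
  · have := RingQuot.mkAlgHom_rel (R0 d) (HRel.comm (d := d) i j h1 (by omega) (by omega) h2 (Or.inl h3))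
    rw [sH_eq d n i h1 (by omega), sH_eq d n j (by omega) h2]
    simpa only [zH, map_mul] using this
  · have := RingQuot.mkAlgHom_rel (R0 d) (HRel.zd (d := d) (n := n))
    simpa only [zH, map_mul, map_pow, map_add, map_sum, map_one, AlgHom.commutes] using this
  · have := RingQuot.mkAlgHom_rel (R0 d) (HRel.sq (d := d) j h1 h2)
    rw [sH_eq d n j h1 h2]
    simpa only [zH, map_mul, map_add, map_one, AlgHom.commutes] using this

/-- The values of a homomorphism on the generators. -/
def genVal {A : Type*} (n : ℕ) (z : A) (s : ℕ → A) : HGen n → A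
  | .z => z
  | .s j _ _ => s j

theorem hecke_lift {A : Type*} [Ring A] {d n : ℕ} [Algebra (R0 d) A] {z : A} {s : ℕ → A}
    (h : HR d n (aV d) (bV d) z s) :
    ∃ f : Hecke d n →ₐ[R0 d] A, f (zH d n) = z ∧ ∀ j, 2 ≤ j → j ≤ n → f (sH d n j) = s j := by
  let g : FA d n →ₐ[R0 d] A := FreeAlgebra.lift (R0 d) (genVal n z s)
  have gz : g (FreeAlgebra.ι (R0 d) HGen.z) = z := FreeAlgebra.lift_ι_apply _ _
  have gs : ∀ j h1 h2, g (FreeAlgebra.ι (R0 d) (HGen.s j h1 h2)) = s j := fun j h1 h2 =>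
    FreeAlgebra.lift_ι_apply _ _
  have hg : ∀ x y, HRel d n x y → g x = g y := by
    intro x y hxy
    cases hxy with
    | zszs h2 => simp only [map_mul, gz, gs]; exact h.zszs h2
    | zs j h2 h3 hn => simp only [map_mul, gz, gs]; exact h.zs j h3 hn
    | braid i h2 h2' hn' hn => simp only [map_mul, gs]; exact h.braid i h2 hn
    | comm i j h2i hni h2j hnj hij =>
      simp only [map_mul, gs]
      rcases hij with hij | hij
      · exact h.comm i j h2i hnj hij
      · exact (h.comm j i h2j hni hij).symm
    | zd =>
      simp only [map_mul, map_pow, map_add, map_sum, map_one, AlgHom.commutes, gz]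
      exact h.zd
    | sq j h2 hn =>
      simp only [map_mul, map_add, map_one, AlgHom.commutes, gs]
      exact h.sq j h2 hn
  refine ⟨RingQuot.liftAlgHom (R0 d) ⟨g, fun {x y} => hg x y⟩, ?_, fun j h1 h2 => ?_⟩
  · unfold zH
    rw [RingQuot.liftAlgHom_mkAlgHom_apply]; exact gz
  · rw [sH_eq d n j h1 h2, RingQuot.liftAlgHom_mkAlgHom_apply]; exact gs j h1 h2

theorem hecke_induction {d n : ℕ} {P : Hecke d n → Prop}
    (alg : ∀ r, P (algebraMap (R0 d) (Hecke d n) r)) (hz : P (zH d n))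
    (hs : ∀ j, 2 ≤ j → j ≤ n → P (sH d n j)) (mul : ∀ x y, P x → P y → P (x * y))
    (hadd : ∀ x y, P x → P y → P (x + y)) (x : Hecke d n) : P x := by
  obtain ⟨y, rfl⟩ := RingQuot.mkAlgHom_surjective (R0 d) (HRel d n) x
  induction y using FreeAlgebra.induction with
  | grade0 r => rw [AlgHom.commutes]; exact alg r
  | grade1 g =>
    cases g with
    | z => exact hz
    | s j h1 h2 => rw [← sH_eq]; exact hs j h1 h2
  | mul a b ha hb => rw [map_mul]; exact mul _ _ ha hb
  | add a b ha hb => rw [map_add]; exact hadd _ _ ha hb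

theorem HR.mono {R A : Type*} [CommRing R] [Ring A] [Algebra R A] {d n : ℕ} {a : R} {b : ℕ → R}
    {z : A} {s : ℕ → A} (h : HR d (n+1) a b z s) : HR d n a b z s :=
  ⟨fun h1 => h.zszs (by omega), fun j h1 h2 => h.zs j h1 (by omega),
    fun i h1 h2 => h.braid i h1 (by omega), fun i j h1 h2 h3 => h.comm i j h1 (by omega) h3,
    h.zd, fun j h1 h2 => h.sq j h1 (by omega)⟩

theorem hecke_incl (d m : ℕ) : ∃ f : Hecke d m →ₐ[R0 d] Hecke d (m+1), f (zH d m) = zH d (m+1) ∧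
    ∀ j, 2 ≤ j → j ≤ m → f (sH d m j) = sH d (m+1) j :=
  hecke_lift (hecke_HR d (m+1)).mono

theorem incl_lam {d m : ℕ} (f : Hecke d m →ₐ[R0 d] Hecke d (m+1)) (hz : f (zH d m) = zH d (m+1))
    (hs : ∀ j, 2 ≤ j → j ≤ m → f (sH d m j) = sH d (m+1) j) (i : ℕ) (hi : i ≤ m)
    (l : LamIdx d i) : f (lamEvalH d m i l) = lamEvalH d (m+1) i l := by
  have hD : ∀ j, 2 ≤ j → f (sDescH d m i j) = sDescH d (m+1) i j := by
    intro j hj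
    unfold sDescH
    rw [map_list_prod, List.map_map]
    congr 1
    apply List.map_congr_left
    intro k hk
    simp only [List.mem_reverse, List.mem_range'_1] at hk
    exact hs k (by omega) (by omega)
  have hA : ∀ j, j ≤ i → f (sAscH d m 2 j) = sAscH d (m+1) 2 j := by
    intro j hj
    unfold sAscH
    rw [map_list_prod, List.map_map]
    congr 1
    apply List.map_congr_left
    intro k hk
    simp only [List.mem_range'_1] at hk
    exact hs k (by omega) (by omega)
  cases l with
  | one => simp [lamEvalH]
  | sdesc j h1 h2 => exact hD j h1
  | sz k h1 h2 => simp only [lamEvalH, map_mul, map_pow, hD 2 le_rfl, hz]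
  | szs k h1 h2 j h3 h4 => simp only [lamEvalH, map_mul, map_pow, hD 2 le_rfl, hz, hA j h4]

end HeckeBasics

section Constr
variable {R B : Type*} [CommRing R] [Ring B] [Algebra R B]

/-- The basis vectors of the string of the `s_m ⋯ s_i`. -/
def Dv (d m : ℕ) (B : Type*) [Ring B] (i : ℕ) : LamIdx d (m+1) →₀ B :=
  if h : 2 ≤ i ∧ i ≤ m + 1 then Finsupp.single (.sdesc i h.1 h.2) 1 else Finsupp.single .one 1

/-- The basis vectors of the strings of the `s_m ⋯ s_2 z^k s_2 ⋯ s_i`. -/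
def Fv (d m : ℕ) (B : Type*) [Ring B] (k i : ℕ) : LamIdx d (m+1) →₀ B :=
  if h : 1 ≤ k ∧ k < d then
    if h2 : 2 ≤ i ∧ i ≤ m + 1 then Finsupp.single (.szs k h.1 h.2 i h2.1 h2.2) 1
    else Finsupp.single (.sz k h.1 h.2) 1
  else 0

/-- Selector of values. -/
def opVal {d m : ℕ} {M : Type*} (DD : ℕ → M) (FF : ℕ → ℕ → M) : LamIdx d (m+1) → M
  | .one => DD (m+2)
  | .sdesc i _ _ => DD i
  | .sz k _ _ => FF k 1
  | .szs k _ _ i _ _ => FF k i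

/-- Linear map with prescribed values on the basis vectors. -/
def mkOp {d m : ℕ} {M : Type*} [AddCommGroup M] [Module B M] (DD : ℕ → M) (FF : ℕ → ℕ → M) :
    (LamIdx d (m+1) →₀ B) →ₗ[B] M :=
  Finsupp.linearCombination B (opVal DD FF)

theorem mkOp_D {d m : ℕ} {M : Type*} [AddCommGroup M] [Module B M] (DD : ℕ → M) (FF : ℕ → ℕ → M)
    (i : ℕ) (h1 : 2 ≤ i) (h2 : i ≤ m + 2) : mkOp DD FF (Dv d m B i) = DD i := by
  unfold mkOp Dv
  split_ifs with h
  · simp [opVal]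
  · obtain rfl : i = m + 2 := by omega
    simp [opVal]

theorem mkOp_F {d m : ℕ} {M : Type*} [AddCommGroup M] [Module B M] (DD : ℕ → M) (FF : ℕ → ℕ → M)
    (k i : ℕ) (hk : 1 ≤ k) (hk2 : k < d) (h1 : 1 ≤ i) (h2 : i ≤ m + 1) :
    mkOp DD FF (Fv d m B k i) = FF k i := by
  unfold mkOp Fv
  rw [dif_pos ⟨hk, hk2⟩]
  split_ifs with h
  · simp [opVal]
  · obtain rfl : i = 1 := by omega
    simp [opVal]

theorem DF_ext {d m : ℕ} {M : Type*} [AddCommGroup M] [Module B M]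
    (f g : (LamIdx d (m+1) →₀ B) →ₗ[B] M)
    (h1 : ∀ i, 2 ≤ i → i ≤ m + 2 → f (Dv d m B i) = g (Dv d m B i))
    (h2 : ∀ k i, 1 ≤ k → k < d → 1 ≤ i → i ≤ m + 1 → f (Fv d m B k i) = g (Fv d m B k i)) :
    f = g := by
  apply Finsupp.lhom_ext'
  intro l
  apply LinearMap.ext_ring
  show f (Finsupp.single l 1) = g (Finsupp.single l 1)
  cases l with
  | one => simpa [Dv] using h1 (m+2) (by omega) (by omega)
  | sdesc i h3 h4 => simpa [Dv, h3, h4] using h1 i (by omega) (by omega)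
  | sz k h3 h4 => simpa [Fv, h3, h4] using h2 k 1 h3 h4 (by omega) (by omega)
  | szs k h3 h4 i h5 h6 => simpa [Fv, h3, h4, h5, h6] using h2 k i h3 h4 (by omega) (by omega)

variable (d m : ℕ) (a : R) (b : ℕ → R) (z : B) (s : ℕ → B)

/-- The action of `s_j` on the module. -/
def Sop (j : ℕ) : (LamIdx d (m+1) →₀ B) →ₗ[B] (LamIdx d (m+1) →₀ B) :=
  mkOp (fun i => if j + 2 ≤ i then s j • Dv d m B i else if i = j + 1 then Dv d m B j
      else if i = j then algebraMap R B a • Dv d m B j + Dv d m B (j+1) else s (j-1) • Dv d m B i)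
    (fun k i => if j = i + 1 then Fv d m B k (i+1)
      else if j = i then algebraMap R B a • Fv d m B k i + Fv d m B k (i-1)
      else if j < i then s j • Fv d m B k i else s (j-1) • Fv d m B k i)

/-- The action of `z` on the module. -/
def Zop : (LamIdx d (m+1) →₀ B) →ₗ[B] (LamIdx d (m+1) →₀ B) :=
  mkOp (fun i => if i = 2 then Fv d m B 1 1 else z • Dv d m B i)
    (fun k i => if i = 1 then
        if k + 1 < d then Fv d m B (k+1) 1
        else ∑ i ∈ Finset.Icc 1 (d-1), algebraMap R B (b i) • Fv d m B (d-i) 1 + Dv d m B 2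
      else z • Fv d m B k i + algebraMap R B a • (z ^ k * WW s (i-2)) • Fv d m B 1 1
        - algebraMap R B a • (z * WW s (i-2)) • Fv d m B k 1)

theorem MD_constr (hd : 2 ≤ d) (hm : 1 ≤ m) :
    MD d m a b z s (Dv d m B) (Fv d m B) (Sop d m a s) (Zop d m a b z s) := by
  refine ⟨⟨fun i h1 h2 => ?_, fun i h1 h2 => ?_, fun i j h1 h2 h3 => ?_, fun i j h1 h2 h3 => ?_⟩,
    fun k hk hk2 => ⟨fun i h1 h2 => ?_, fun i h1 h2 => ?_, fun i j h1 h2 h3 => ?_,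
      fun i j h1 h2 h3 => ?_⟩, fun i h1 h2 => ?_, ?_, fun k h1 h2 => ?_, ?_, fun k t h1 h2 h3 => ?_⟩
  · rw [Sop, mkOp_D _ _ _ (by omega) (by omega), if_neg (by omega), if_neg (by omega), if_pos rfl]
  · rw [Sop, mkOp_D _ _ _ (by omega) (by omega), if_neg (by omega), if_pos rfl, zero_smul, zero_add]
  · rw [Sop, mkOp_D _ _ _ (by omega) (by omega), if_pos (by omega)]
  · rw [Sop, mkOp_D _ _ _ (by omega) (by omega), if_neg (by omega), if_neg (by omega),
      if_neg (by omega), Nat.add_sub_cancel]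
  · rw [Sop, mkOp_F _ _ _ _ hk hk2 (by omega) (by omega), if_pos rfl, zero_smul, zero_add]
  · rw [Sop, mkOp_F _ _ _ _ hk hk2 (by omega) (by omega), if_neg (by omega), if_pos rfl,
      Nat.add_sub_cancel]
  · rw [Sop, mkOp_F _ _ _ _ hk hk2 (by omega) (by omega), if_neg (by omega), if_neg (by omega),
      if_pos (by omega)]
  · rw [Sop, mkOp_F _ _ _ _ hk hk2 (by omega) (by omega), if_neg (by omega), if_neg (by omega),
      if_neg (by omega), Nat.add_sub_cancel]
  · rw [Zop, mkOp_D _ _ _ (by omega) (by omega), if_neg (by omega)]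
  · rw [Zop, mkOp_D _ _ _ (by omega) (by omega), if_pos rfl]
  · rw [Zop, mkOp_F _ _ _ _ h1 (by omega) (by omega) (by omega), if_pos rfl, if_pos h2]
  · rw [Zop, mkOp_F _ _ _ _ (by omega) (by omega) (by omega) (by omega), if_pos rfl,
      if_neg (by omega)]
  · rw [Zop, mkOp_F _ _ _ _ h1 h2 (by omega) (by omega), if_neg (by omega), Nat.add_sub_cancel]

end Constr

section Step
open MulOpposite

/-- An algebra with generators `z, s_j` presented by the Hecke relations. -/
structure Pres {R A : Type} [CommRing R] [Ring A] [Algebra R A] (d n : ℕ) (a : R) (b : ℕ → R)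
    (z : A) (s : ℕ → A) : Prop where
  hr : HR d n a b z s
  ind : ∀ P : A → Prop, (∀ r, P (algebraMap R A r)) → P z → (∀ j, 2 ≤ j → j ≤ n → P (s j)) →
    (∀ x y, P x → P y → P (x * y)) → (∀ x y, P x → P y → P (x + y)) → ∀ x, P x
  lift : ∀ (C : Type) [Ring C] [Algebra R C] (z' : C) (s' : ℕ → C), HR d n a b z' s' →
    ∃ f : A →ₐ[R] C, f z = z' ∧ ∀ j, 2 ≤ j → j ≤ n → f (s j) = s' j

theorem Pres.top {R A : Type} [CommRing R] [Ring A] [Algebra R A] {d n : ℕ} {a : R} {b : ℕ → R}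
    {z : A} {s : ℕ → A} (h : Pres d n a b z s) (N : Submodule R A) (h1 : 1 ∈ N)
    (hz : ∀ x ∈ N, x * z ∈ N) (hs : ∀ j, 2 ≤ j → j ≤ n → ∀ x ∈ N, x * s j ∈ N) :
    N = ⊤ := by
  rw [eq_top_iff]
  intro y _
  have : ∀ x ∈ N, x * y ∈ N := by
    refine h.ind (fun y => ∀ x ∈ N, x * y ∈ N) ?_ hz hs ?_ ?_ y
    · intro r x hx; rw [← Algebra.commutes, ← Algebra.smul_def]; exact N.smul_mem _ hx
    · intro u v hu hv x hx; rw [← mul_assoc]; exact hv _ (hu _ hx)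
    · intro u v hu hv x hx; rw [mul_add]; exact N.add_mem (hu _ hx) (hv _ hx)
  simpa using this 1 h1

/-- Evaluation of a listed expression in an arbitrary algebra. -/
def lamG {A : Type} [Ring A] {d : ℕ} (z : A) (s : ℕ → A) (m : ℕ) : LamIdx d m → A
  | .one => 1
  | .sdesc i' _ _ => DL s m i'
  | .sz k _ _ => DL s m 2 * z ^ k
  | .szs k _ _ i' _ _ => DL s m 2 * z ^ k * WW s (i' - 1)

variable {R B H : Type} [CommRing R] [Ring B] [Algebra R B] [Ring H] [Algebra R H] {d m : ℕ}
  {a : R} {b : ℕ → R} {z : B} {s : ℕ → B} {zh : H} {sh : ℕ → H}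

/-- The comparison map `h e_λ ↦ h λ`. -/
def PhiMap (d m : ℕ) (f : B →ₐ[R] H) (zh : H) (sh : ℕ → H) :
    (LamIdx d (m+1) →₀ B) →ₗ[R] H :=
  Finsupp.lsum R (fun l =>
    (LinearMap.mulRight R (lamG zh sh (m+1) l)) ∘ₗ f.toLinearMap)

theorem PhiMap_single (f : B →ₐ[R] H) (l : LamIdx d (m+1))
    (h : B) : PhiMap d m f zh sh (Finsupp.single l h) = f h * lamG zh sh (m+1) l := by
  simp [PhiMap]

theorem PhiMap_inj (hd : 2 ≤ d) (hm : 1 ≤ m) (hB : Pres d m a b z s)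
    (hH : Pres d (m+1) a b zh sh) (f : B →ₐ[R] H) (hz : f z = zh)
    (hs : ∀ j, 2 ≤ j → j ≤ m → f (s j) = sh j) : Function.Injective (PhiMap d m f zh sh) := by
  have hMD := MD_constr d m a b z s hd hm
  have hHR := hMD.toHR (hB.hr) hd hm DF_ext
  obtain ⟨ρ, ρz, ρs⟩ := hH.lift _ _ _ hHR
  obtain ⟨act, hact⟩ : ∃ act : H → Module.End B (LamIdx d (m+1) →₀ B),
    ∀ x, act x = unop (ρ x) := ⟨_, fun _ => rfl⟩
  have amul : ∀ x y v, act (x * y) v = act y (act x v) := by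
    intro x y v
    rw [hact, hact, hact, map_mul, unop_mul]; rfl
  have aadd : ∀ x y v, act (x + y) v = act x v + act y v := by
    intro x y v
    rw [hact, hact, hact, map_add, unop_add]; rfl
  have aalg : ∀ r v, act (algebraMap _ _ r) v = algebraMap (R) B r • v := by
    intro r v
    rw [hact, AlgHom.commutes, algebraMap_smul]; rfl
  have az : ∀ v, act (zh) v = Zop d m a b z s v := by
    intro v; rw [hact, ρz]; rfl
  have as : ∀ j, 2 ≤ j → j ≤ m + 1 → ∀ v, act (sh j) v = Sop d m a s j v := by
    intro j h1 h2 v; rw [hact, ρs j h1 h2]; rfl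
  have ak : ∀ k x v, act (x * zh ^ k) v =
      (Zop d m a b z s ^ k) (act x v) := by
    intro k
    induction k with
    | zero => intro x v; rw [pow_zero, mul_one, pow_zero]; rfl
    | succ k ih => intro x v; rw [pow_succ, ← mul_assoc, amul, ih, az, pow_succ']; rfl
  have c1 : ∀ h, act (f h) (Dv d m _ (m+2)) = h • Dv d m _ (m+2) := by
    refine hB.ind (fun h => act (f h) (Dv d m _ (m+2)) = h • Dv d m _ (m+2)) ?_ ?_ ?_ ?_ ?_
    · intro r; rw [AlgHom.commutes, aalg]
    · rw [hz, az, hMD.zD _ (by omega) (by omega)]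
    · intro j h1 h2
      rw [hs j h1 h2, as j h1 (by omega)]
      exact hMD.Dps.lo (m+1) j h1 (by omega) (by omega)
    · intro x y hx hy; rw [map_mul, amul, hx, map_smul, hy, mul_smul]
    · intro x y hx hy; rw [map_add, aadd, hx, hy, add_smul]
  have c2 : ∀ i, 2 ≤ i → i ≤ m + 2 → act (DL sh (m+1) i) (Dv d m _ (m+2)) = Dv d m _ i := by
    intro i h1 h2
    obtain ⟨t, ht⟩ : ∃ t, i + t = m + 2 := ⟨m + 2 - i, by omega⟩
    induction t generalizing i with
    | zero =>
      obtain rfl : i = m + 2 := by omega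
      rw [DL_top, ← map_one f, c1, one_smul]
    | succ t ih =>
      rw [DL_succ _ _ _ (by omega), amul, ih (i+1) (by omega) (by omega) (by omega),
        as i h1 (by omega)]
      obtain ⟨i, rfl⟩ : ∃ i', i = i' + 1 := ⟨i - 1, by omega⟩
      have := hMD.Dps.dn i (by omega) (by omega)
      rw [zero_smul, zero_add] at this
      exact this
  have c3 : ∀ k, 1 ≤ k → k < d → act (DL sh (m+1) 2 * zh ^ k) (Dv d m _ (m+2))
      = Fv d m _ k 1 := by
    intro k h1 h2
    rw [ak, c2 2 le_rfl (by omega), hMD.Epow k h1 h2]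
  have c4 : ∀ k t, 1 ≤ k → k < d → t ≤ m → act (DL sh (m+1) 2 * zh ^ k *
      WW sh t) (Dv d m _ (m+2)) = Fv d m _ k (t+1) := by
    intro k t h1 h2 h3
    induction t with
    | zero => rw [WW, mul_one]; exact c3 k h1 h2
    | succ t ih =>
      rw [WW, ← mul_assoc, amul, ih (by omega), as _ (by omega) (by omega),
        (hMD.Fps k h1 h2).up (t+1) (by omega) (by omega), zero_smul, zero_add]
  have c5 : ∀ l : LamIdx d (m+1), act (lamG zh sh (m+1) l) (Dv d m _ (m+2)) = Finsupp.single l 1 := by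
    intro l
    cases l with
    | one =>
      have := c1 1
      rw [map_one, one_smul] at this
      rw [lamG, this, Dv, dif_neg (by omega)]
    | sdesc i h1 h2 => rw [lamG, c2 i h1 (by omega), Dv, dif_pos ⟨h1, h2⟩]
    | sz k h1 h2 => rw [lamG, c3 k h1 h2, Fv, dif_pos ⟨h1, h2⟩, dif_neg (by omega)]
    | szs k h1 h2 i h3 h4 =>
      obtain ⟨i, rfl⟩ : ∃ i', i = i' + 1 := ⟨i - 1, by omega⟩
      rw [lamG, Nat.add_sub_cancel, c4 k i h1 h2 (by omega), Fv, dif_pos ⟨h1, h2⟩, dif_pos ⟨h3, h4⟩]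
  have key : ∀ v, act (PhiMap d m f zh sh v) (Dv d m _ (m+2)) = v := by
    intro v
    induction v using Finsupp.induction_linear with
    | zero =>
      have := aalg 0 (Dv d m _ (m+2))
      rw [map_zero, map_zero, zero_smul] at this
      rw [map_zero, this]
    | add x y hx hy => rw [map_add, aadd, hx, hy]
    | single l h => rw [PhiMap_single, amul, c1, map_smul, c5, Finsupp.smul_single, smul_eq_mul, mul_one]
  exact Function.LeftInverse.injective (g := fun x => act x (Dv d m _ (m+2))) key

theorem PhiMap_surj (hd : 2 ≤ d) (hm : 1 ≤ m) (hB : Pres d m a b z s)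
    (hH : Pres d (m+1) a b zh sh) (f : B →ₐ[R] H) (hz : f z = zh)
    (hs : ∀ j, 2 ≤ j → j ≤ m → f (s j) = sh j) : Function.Surjective (PhiMap d m f zh sh) := by
  rw [← LinearMap.range_eq_top]
  have hl : ∀ h x, x ∈ LinearMap.range (PhiMap d m f zh sh) → f h * x ∈ LinearMap.range (PhiMap d m f zh sh) := by
    rintro h _ ⟨v, rfl⟩
    induction v using Finsupp.induction_linear with
    | zero => rw [map_zero, mul_zero]; exact Submodule.zero_mem _
    | add x y hx hy => rw [map_add, mul_add]; exact Submodule.add_mem _ hx hy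
    | single l g =>
      refine ⟨Finsupp.single l (h * g), ?_⟩
      rw [PhiMap_single, PhiMap_single, map_mul, mul_assoc]
  have hm1 : ∀ l : LamIdx d (m+1), lamG zh sh (m+1) l ∈ LinearMap.range (PhiMap d m f zh sh) := fun l =>
    ⟨Finsupp.single l 1, by rw [PhiMap_single, map_one, one_mul]⟩
  have h1 : (1 : H) ∈ LinearMap.range (PhiMap d m f zh sh) := hm1 .one
  have hr : ∀ g, (∀ l : LamIdx d (m+1), lamG zh sh (m+1) l * g ∈ LinearMap.range (PhiMap d m f zh sh)) →
      ∀ x ∈ LinearMap.range (PhiMap d m f zh sh), x * g ∈ LinearMap.range (PhiMap d m f zh sh) := by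
    rintro g hg _ ⟨v, rfl⟩
    induction v using Finsupp.induction_linear with
    | zero => rw [map_zero, zero_mul]; exact Submodule.zero_mem _
    | add x y hx hy => rw [map_add, add_mul]; exact Submodule.add_mem _ hx hy
    | single l h =>
      rw [PhiMap_single, mul_assoc]
      exact hl _ _ (hg l)
  have hH1 := hH.hr
  have hSP : SP d m (zh) sh (LinearMap.range (PhiMap d m f zh sh)) := by
    refine ⟨fun x hx => ?_, fun j h1 h2 x hx => ?_, fun i h1 h2 => ?_, fun k t h1 h2 h3 => ?_⟩
    · have := hl z x hx; rwa [hz] at this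
    · rw [← hs j h1 h2]; exact hl _ _ hx
    · rcases eq_or_lt_of_le h2 with h2 | h2
      · subst h2; rw [DL_top]; exact hm1 .one
      · exact hm1 (.sdesc i h1 (by omega))
    · rcases Nat.eq_zero_or_pos t with h0 | h0
      · subst h0; rw [WW, mul_one]; exact hm1 (.sz k h1 h2)
      · exact hm1 (.szs k h1 h2 (t+1) (by omega) (by omega))
  have hD1 : (1 : H) = DL sh (m+1) (m+2) := (DL_top sh (m+1)).symm
  refine hH.top _ h1 (hr _ fun l => ?_) (fun j hj hj2 => hr _ fun l => ?_)
  · cases l with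
    | one => rw [lamG, hD1]; exact hSP.D_z hH1 hd _ (by omega) (by omega)
    | sdesc i h1 h2 => exact hSP.D_z hH1 hd i h1 (by omega)
    | sz k h1 h2 =>
      have := hSP.F_z hH1 hd k 0 h1 h2 (by omega)
      rw [WW, mul_one] at this
      exact this
    | szs k h1 h2 i h3 h4 =>
      obtain ⟨i, rfl⟩ : ∃ i', i = i' + 1 := ⟨i - 1, by omega⟩
      rw [lamG, Nat.add_sub_cancel]
      exact hSP.F_z hH1 hd k i h1 h2 (by omega)
  · cases l with
    | one => rw [lamG, hD1]; exact hSP.D_s hH1 _ j (by omega) (by omega) hj hj2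
    | sdesc i h1 h2 => exact hSP.D_s hH1 i j h1 (by omega) hj hj2
    | sz k h1 h2 =>
      have := hSP.F_s hH1 k 0 j h1 h2 (by omega) hj hj2
      rw [WW, mul_one] at this
      exact this
    | szs k h1 h2 i h3 h4 =>
      obtain ⟨i, rfl⟩ : ∃ i', i = i' + 1 := ⟨i - 1, by omega⟩
      rw [lamG, Nat.add_sub_cancel]
      exact hSP.F_s hH1 k i j h1 h2 (by omega) hj hj2

theorem step_basis (hd : 2 ≤ d) (hm : 1 ≤ m) (hB : Pres d m a b z s)
    (hH : Pres d (m+1) a b zh sh) (f : B →ₐ[R] H) (hz : f z = zh)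
    (hs : ∀ j, 2 ≤ j → j ≤ m → f (s j) = sh j) {κ : Type} (v : κ → B)
    (hv : LinearIndependent R v) (hsp : Submodule.span R (Set.range v) = ⊤) :
    LinearIndependent R (fun p : LamIdx d (m+1) × κ => f (v p.2) * lamG zh sh (m+1) p.1) ∧
    Submodule.span R (Set.range (fun p : LamIdx d (m+1) × κ => f (v p.2) * lamG zh sh (m+1) p.1))
      = ⊤ := by
  let e := LinearEquiv.ofBijective (PhiMap d m f zh sh)
    ⟨PhiMap_inj hd hm hB hH f hz hs, PhiMap_surj hd hm hB hH f hz hs⟩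
  let b0 := ((Finsupp.basis (fun _ : LamIdx d (m+1) => Module.Basis.mk hv hsp.ge)).map e).reindex
    (Equiv.sigmaEquivProd _ _)
  have hb : (fun p : LamIdx d (m+1) × κ => f (v p.2) * lamG zh sh (m+1) p.1) = b0 := by
    funext p
    simp only [b0, e, Module.Basis.coe_reindex, Function.comp_apply, Module.Basis.map_apply,
      Finsupp.coe_basis, Module.Basis.mk_apply, Equiv.sigmaEquivProd_symm_apply]
    exact (PhiMap_single f p.1 (v p.2)).symm
  rw [hb]
  exact ⟨b0.linearIndependent, b0.span_eq⟩

theorem base_basis [Nontrivial R] (hd : 2 ≤ d) (hB : Pres d 1 a b z s) :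
    LinearIndependent R (fun k : Fin d => z ^ (k : ℕ)) ∧
    Submodule.span R (Set.range (fun k : Fin d => z ^ (k : ℕ))) = ⊤ := by
  constructor
  · let q : Polynomial R := ∑ i ∈ Finset.Icc 1 (d-1), Polynomial.C (b i) * Polynomial.X ^ (d-i) + 1
    have hq : q.degree < d := by
      refine (Polynomial.degree_add_le _ _).trans_lt (max_lt ?_ ?_)
      · refine (Polynomial.degree_sum_le _ _).trans_lt ?_
        rw [Finset.sup_lt_iff (by exact WithBot.bot_lt_coe d)]
        intro i hi
        rw [Finset.mem_Icc] at hi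
        refine (Polynomial.degree_C_mul_X_pow_le _ _).trans_lt ?_
        exact_mod_cast (by omega : d - i < d)
      · rw [Polynomial.degree_one]
        exact_mod_cast (by omega : 0 < d)
    have hmon : (Polynomial.X ^ d - q).Monic := Polynomial.monic_X_pow_sub hq
    have hdeg : (Polynomial.X ^ d - q).natDegree = d := by
      apply Polynomial.natDegree_eq_of_degree_eq_some
      rw [Polynomial.degree_sub_eq_left_of_degree_lt, Polynomial.degree_X_pow]
      rwa [Polynomial.degree_X_pow]
    have hroot : AdjoinRoot.root (Polynomial.X ^ d - q) ^ d =
        ∑ i ∈ Finset.Icc 1 (d-1), algebraMap R _ (b i) *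
          AdjoinRoot.root (Polynomial.X ^ d - q) ^ (d-i) + 1 := by
      have := AdjoinRoot.eval₂_root (Polynomial.X ^ d - q)
      rw [Polynomial.eval₂_sub, sub_eq_zero] at this
      simpa [q, Polynomial.eval₂_add, Polynomial.eval₂_finsetSum, AdjoinRoot.algebraMap_eq] using this
    obtain ⟨g, hg, -⟩ := hB.lift (AdjoinRoot (Polynomial.X ^ d - q))
      (AdjoinRoot.root (Polynomial.X ^ d - q)) (fun _ => 1)
      ⟨by omega, by omega, by omega, by omega, hroot, by omega⟩
    apply LinearIndependent.of_comp g.toLinearMap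
    have h1 := (AdjoinRoot.powerBasis' hmon).basis.linearIndependent
    have h2 : (AdjoinRoot.powerBasis' hmon).dim = d := by
      rw [AdjoinRoot.powerBasis'_dim, hdeg]
    have h3 := h1.comp (finCongr h2.symm) (finCongr h2.symm).injective
    convert h3 using 1
    funext k
    simp [hg]
  · set N := Submodule.span R (Set.range (fun k : Fin d => z ^ (k : ℕ))) with hN
    have hk : ∀ k, k < d → z ^ k ∈ N := fun k h => Submodule.subset_span ⟨⟨k, h⟩, rfl⟩
    refine hB.top N (by simpa using hk 0 (by omega)) ?_ (by omega)
    intro x hx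
    refine Submodule.span_induction (p := fun x _ => x * z ∈ N) ?_ ?_ ?_ ?_ hx
    · rintro _ ⟨⟨k, h⟩, rfl⟩
      dsimp only
      rw [← pow_succ]
      rcases eq_or_lt_of_le (Nat.succ_le_of_lt h) with h1 | h1
      · rw [Nat.succ_eq_add_one] at h1
        rw [h1, hB.hr.zd]
        refine N.add_mem (N.sum_mem fun i hi => ?_) (by simpa using hk 0 (by omega))
        rw [Finset.mem_Icc] at hi
        rw [← Algebra.smul_def]
        exact N.smul_mem _ (hk _ (by omega))
      · exact hk _ h1
    · rw [zero_mul]; exact N.zero_mem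
    · intro x y _ _ hx hy; rw [add_mul]; exact N.add_mem hx hy
    · intro r x _ hx; rw [smul_mul_assoc]; exact N.smul_mem _ hx

end Step

section Final

theorem hecke_pres (d n : ℕ) : Pres d n (aV d) (bV d) (zH d n) (sH d n) :=
  ⟨hecke_HR d n, fun _ h1 h2 h3 h4 h5 => hecke_induction h1 h2 h3 h4 h5,
    fun _ _ _ _ _ h => hecke_lift h⟩

theorem lamEval_eq (d n m : ℕ) (l : LamIdx d m) :
    lamEvalH d n m l = lamG (zH d n) (sH d n) m l := by
  cases l with
  | one => rfl
  | sdesc i h1 h2 => rfl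
  | sz k h1 h2 => rfl
  | szs k h1 h2 i h3 h4 =>
    obtain ⟨i, rfl⟩ : ∃ i', i = i' + 1 := ⟨i - 1, by omega⟩
    exact congrArg (sDescH d n m 2 * zH d n ^ k * ·) (WW_eq (sH d n) i)

theorem nf_step (d k : ℕ) (f : Hecke d (k+1) →ₐ[R0 d] Hecke d (k+1+1))
    (hz : f (zH d (k+1)) = zH d (k+1+1))
    (hs : ∀ j, 2 ≤ j → j ≤ k+1 → f (sH d (k+1) j) = sH d (k+1+1) j)
    (i : Fin d) (q : ∀ j : Fin (k+1), LamIdx d (j.val + 2)) :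
    nfH d (k+1+1) (i, q) = f (nfH d (k+1) (i, fun j : Fin k => q j.castSucc)) *
      lamG (zH d (k+1+1)) (sH d (k+1+1)) (k+1+1) (q (Fin.last k)) := by
  unfold nfH
  change zH d (k+1+1) ^ (i : ℕ) * ((List.finRange (k+1)).map
    (fun j : Fin (k+1) => lamEvalH d (k+1+1) (j.val + 2) (q j))).prod = f (zH d (k+1) ^ (i : ℕ) *
    ((List.finRange k).map (fun j : Fin k => lamEvalH d (k+1) (j.val + 2) (q j.castSucc))).prod) * _
  rw [List.finRange_succ_last, List.map_append, List.prod_append, map_mul, map_pow, hz,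
    map_list_prod, List.map_map, List.map_map, mul_assoc, ← lamEval_eq]
  congr 2
  · congr 1
    apply List.map_congr_left
    intro j _
    exact (incl_lam f hz hs (j.val + 2) (by omega) _).symm
  · simp

theorem nf_basis (d : ℕ) (hd : 2 ≤ d) (k : ℕ) :
    LinearIndependent (R0 d) (nfH d (k+1)) ∧
    Submodule.span (R0 d) (Set.range (nfH d (k+1))) = ⊤ := by
  induction k with
  | zero =>
    obtain ⟨h1, h2⟩ := base_basis hd (hecke_pres d 1)
    have e : nfH d (0+1) = (fun k : Fin d => zH d 1 ^ (k : ℕ)) ∘ Prod.fst := by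
      funext p
      simp [nfH]
    have hinj : Function.Injective (Prod.fst : Fin d × (∀ j : Fin (0 + 1 - 1), LamIdx d (j.val + 2)) → Fin d) := by
      rintro ⟨i, q⟩ ⟨j, r⟩ h
      have : q = r := by funext x; exact x.elim0
      simp_all
    have hsur : Function.Surjective (Prod.fst : Fin d × (∀ j : Fin (0 + 1 - 1), LamIdx d (j.val + 2)) → Fin d) :=
      fun i => ⟨(i, fun x => x.elim0), rfl⟩
    rw [e]
    refine ⟨h1.comp _ hinj, ?_⟩
    rw [hsur.range_comp]; exact h2
  | succ k ih =>
    obtain ⟨f, hz, hs⟩ := hecke_incl d (k+1)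
    obtain ⟨h1, h2⟩ := step_basis hd (by omega) (hecke_pres d (k+1)) (hecke_pres d (k+1+1)) f hz hs
      (nfH d (k+1)) ih.1 ih.2
    let ee : (Fin d × (∀ j : Fin (k+1), LamIdx d (j.val + 2))) →
        LamIdx d (k+1+1) × (Fin d × (∀ j : Fin k, LamIdx d (j.val + 2))) :=
      fun p => (p.2 (Fin.last k), (p.1, fun j => p.2 j.castSucc))
    have hinj : Function.Injective ee := by
      rintro ⟨i, q⟩ ⟨j, r⟩ h
      simp only [ee, Prod.mk.injEq] at h
      obtain ⟨h1, h2, h3⟩ := h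
      have : q = r := by
        funext x
        induction x using Fin.lastCases with
        | last => exact h1
        | cast x => exact congrFun h3 x
      rw [h2, this]
    have hsur : Function.Surjective ee := by
      rintro ⟨l, i, q⟩
      refine ⟨(i, Fin.snoc (α := fun j : Fin (k+1) => LamIdx d (j.val + 2)) q l), ?_⟩
      simp only [ee, Fin.snoc_last, Fin.snoc_castSucc]
    have e : nfH d (k+1+1) = (fun p : LamIdx d (k+1+1) × _ => f (nfH d (k+1) p.2) *
        lamG (zH d (k+1+1)) (sH d (k+1+1)) (k+1+1) p.1) ∘ ee := by
      funext p
      exact nf_step d k f hz hs p.1 p.2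
    rw [e]
    refine ⟨h1.comp _ hinj, ?_⟩
    rw [hsur.range_comp]; exact h2

end Final

/-- The products `a₁ a₂ ⋯ aₙ`, with `a_i` ranging over the listed expressions of
`Λ_i`, are pairwise distinct and form an `R₀`-basis of `H(d,1,n)`. -/
theorem Lambda_is_basis_of_Hd1n (d n : ℕ) (hd : 2 ≤ d) (hn : 2 ≤ n) :
    Function.Injective (nfH d n) ∧
    LinearIndependent (R0 d) (nfH d n) ∧
    Submodule.span (R0 d) (Set.range (nfH d n)) = ⊤ := by
  obtain ⟨k, rfl⟩ : ∃ k, n = k + 1 := ⟨n - 1, by omega⟩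
  obtain ⟨h1, h2⟩ := nf_basis d hd k
  exact ⟨h1.injective, h1, h2⟩
end
end

section
/- In H(d,1,n), for every 1 ≤ k ≤ d−1, the element (s₂ z s₂)^k belongs to the R₀-span of the products λ₁λ₂ with λ₁ ∈ Λ₁ and λ₂ ∈ Λ'₂, where Λ'₂ = {1, s₂, s₂z, s₂z², …, s₂z^{k−1}, s₂zs₂, s₂z²s₂, …, s₂z^k s₂}. -/
noncomputable section

open scoped Pointwise

open FreeAlgebra

/-- `Λ'₂ = {1, s₂, s₂z, …, s₂z^{k-1}, s₂zs₂, s₂z²s₂, …, s₂z^k s₂}`. -/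
def Lam2' (d n k : ℕ) : Set (Hecke d n) :=
  {1} ∪ {x | ∃ m < k, x = sH d n 2 * zH d n ^ m} ∪
    {x | ∃ m, 1 ≤ m ∧ m ≤ k ∧ x = sH d n 2 * zH d n ^ m * sH d n 2}

/-- Powers of `z` times `{1, s z^m (m<k), s z^m s (1≤m≤k)}`. -/
def genSet {A : Type*} [Semiring A] (s z : A) (k : ℕ) : Set A :=
  {x | ∃ i : ℕ, x = z ^ i ∨ (∃ m < k, x = z ^ i * (s * z ^ m)) ∨
    ∃ m, 1 ≤ m ∧ m ≤ k ∧ x = z ^ i * (s * z ^ m * s)}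

theorem gen_pow_mem {R A : Type*} [CommSemiring R] [Semiring A] [Algebra R A] (s z : A) (a : R)
    (hs : s * s = a • s + 1) (hc : Commute (s * z * s) z) (k : ℕ) :
    (s * z * s) ^ (k + 1) ∈ Submodule.span R (genSet s z (k + 1)) := by
  induction k with
  | zero =>
    exact Submodule.subset_span ⟨0, Or.inr (Or.inr ⟨1, le_rfl, le_rfl, by simp⟩)⟩
  | succ k ih =>
    have h1 : ∀ i m, m < k + 2 →
        z ^ i * (s * z ^ m) ∈ Submodule.span R (genSet s z (k + 1 + 1)) := fun i m hm =>
      Submodule.subset_span ⟨i, Or.inr (Or.inl ⟨m, hm, rfl⟩)⟩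
    have h2 : ∀ i m, 1 ≤ m → m ≤ k + 2 →
        z ^ i * (s * z ^ m * s) ∈ Submodule.span R (genSet s z (k + 1 + 1)) := fun i m hm hm' =>
      Submodule.subset_span ⟨i, Or.inr (Or.inr ⟨m, hm, hm', rfl⟩)⟩
    have hzi : ∀ i : ℕ, s * z * s * z ^ i = z ^ i * (s * z * s) := fun i => (hc.pow_right i).eq
    have key : ∀ m : ℕ, s * z * s * (s * z ^ m) =
        a • (z ^ m * (s * z ^ 1 * s)) + s * z ^ (m + 1) := by
      intro m
      calc s * z * s * (s * z ^ m) = s * z * (s * s) * z ^ m := by simp only [mul_assoc]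
        _ = a • (s * z * s * z ^ m) + s * z ^ (m + 1) := by
          rw [hs, pow_succ' z m]
          simp only [mul_add, add_mul, mul_one, mul_smul_comm, smul_mul_assoc, mul_assoc]
        _ = _ := by rw [hzi, pow_one]
    rw [pow_succ' _ (k + 1)]
    generalize (s * z * s) ^ (k + 1) = y at ih
    induction ih using Submodule.span_induction with
    | zero => simp
    | add x y _ _ hx hy => rw [mul_add]; exact add_mem hx hy
    | smul r x _ hx => rw [mul_smul_comm]; exact Submodule.smul_mem _ _ hx
    | mem x hx =>
      obtain ⟨i, rfl | ⟨m, hm, rfl⟩ | ⟨m, hm, hm', rfl⟩⟩ := hx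
      · rw [hzi]
        simpa using h2 i 1 le_rfl (by omega)
      · rw [← mul_assoc, hzi, mul_assoc, key, mul_add, mul_smul_comm, ← mul_assoc, ← pow_add]
        exact add_mem (Submodule.smul_mem _ _ (h2 _ _ le_rfl (by omega))) (h1 _ _ (by omega))
      · have e : z ^ i * (z ^ m * (s * z ^ 1 * s)) * s =
            a • (z ^ (i + m) * (s * z ^ 1 * s)) + z ^ (i + m) * (s * z ^ 1) := by
          calc _ = z ^ (i + m) * (s * z ^ 1 * (s * s)) := by rw [pow_add]; simp only [mul_assoc]
            _ = _ := by
              rw [hs]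
              simp only [mul_add, mul_one, mul_smul_comm]
        rw [← mul_assoc, hzi, mul_assoc, ← mul_assoc (s * z * s), key, ← mul_assoc, mul_add,
          add_mul, mul_smul_comm, smul_mul_assoc, e, mul_assoc (z ^ i) (s * z ^ (m + 1)) s]
        exact add_mem (Submodule.smul_mem _ _ (add_mem
          (Submodule.smul_mem _ _ (h2 _ _ le_rfl (by omega))) (h1 _ _ (by omega))))
          (h2 _ _ (by omega) (by omega))

theorem zH_pow_mem (d n : ℕ) (hd : 2 ≤ d) (i : ℕ) :
    zH d n ^ i ∈ Submodule.span (R0 d) (Lam1 d n) := by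
  have hz : zH d n ^ d = (∑ i ∈ Finset.Icc 1 (d - 1), bV d i • zH d n ^ (d - i)) + 1 := by
    have := RingQuot.mkAlgHom_rel (R0 d) (HRel.zd (d := d) (n := n))
    rw [zH]
    simpa only [map_pow, map_add, map_sum, map_mul, map_one, AlgHom.commutes,
      ← Algebra.smul_def, map_smul] using this
  have hb : ∀ j < d, zH d n ^ j ∈ Submodule.span (R0 d) (Lam1 d n) := fun j hj =>
    Submodule.subset_span ⟨j, hj, rfl⟩
  have hdd : zH d n ^ d ∈ Submodule.span (R0 d) (Lam1 d n) := by
    rw [hz]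
    refine add_mem (Submodule.sum_mem _ fun j hj => Submodule.smul_mem _ _ (hb _ ?_)) ?_
    · rw [Finset.mem_Icc] at hj
      omega
    · simpa using hb 0 (by omega)
  induction i with
  | zero => exact hb 0 (by omega)
  | succ i ih =>
    rw [pow_succ]
    generalize zH d n ^ i = y at ih
    induction ih using Submodule.span_induction with
    | zero => simp
    | add x y _ _ hx hy => rw [add_mul]; exact add_mem hx hy
    | smul r x _ hx => rw [smul_mul_assoc]; exact Submodule.smul_mem _ _ hx
    | mem x hx =>
      obtain ⟨j, hj, rfl⟩ := hx
      rw [← pow_succ]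
      rcases Nat.lt_or_ge (j + 1) d with h | h
      · exact hb _ h
      · have : j + 1 = d := by omega
        rw [this]; exact hdd

/-- For `1 ≤ k ≤ d-1`, `(s₂ z s₂)^k` lies in the `R₀`-span of `Λ₁Λ'₂`. -/
theorem s2zs2_pow_mem_span (d n : ℕ) (hd : 2 ≤ d) (hn : 2 ≤ n)
    (k : ℕ) (hk1 : 1 ≤ k) (hk : k ≤ d - 1) :
    (sH d n 2 * zH d n * sH d n 2) ^ k ∈
      Submodule.span (R0 d) (Lam1 d n * Lam2' d n k) := by
  have hs : sH d n 2 * sH d n 2 = aV d • sH d n 2 + 1 := by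
    have := RingQuot.mkAlgHom_rel (R0 d) (HRel.sq (d := d) (n := n) 2 le_rfl hn)
    have h2 : 2 ≤ 2 ∧ 2 ≤ n := ⟨le_rfl, hn⟩
    rw [sH, dif_pos h2]
    simpa only [map_add, map_mul, map_one, AlgHom.commutes, ← Algebra.smul_def, map_smul] using this
  have hc : Commute (sH d n 2 * zH d n * sH d n 2) (zH d n) := by
    have := RingQuot.mkAlgHom_rel (R0 d) (HRel.zszs (d := d) (n := n) hn)
    have h2 : 2 ≤ 2 ∧ 2 ≤ n := ⟨le_rfl, hn⟩
    rw [sH, dif_pos h2, commute_iff_eq]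
    simp only [map_mul] at this
    simp only [zH, ← mul_assoc]
    exact this.symm
  have hmul : ∀ i, ∀ v ∈ Lam2' d n k,
      zH d n ^ i * v ∈ Submodule.span (R0 d) (Lam1 d n * Lam2' d n k) := by
    intro i v hv
    rw [← Submodule.span_mul_span]
    exact Submodule.mul_mem_mul (zH_pow_mem d n hd i) (Submodule.subset_span hv)
  obtain ⟨k, rfl⟩ : ∃ l, k = l + 1 := ⟨k - 1, by omega⟩
  refine Submodule.span_le.2 ?_ (gen_pow_mem _ _ (aV d) hs hc k)
  rintro x ⟨i, rfl | ⟨m, hm, rfl⟩ | ⟨m, hm, hm', rfl⟩⟩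
  · simpa using hmul i 1 (Or.inl (Or.inl rfl))
  · exact hmul i _ (Or.inl (Or.inr ⟨m, hm, rfl⟩))
  · exact hmul i _ (Or.inr ⟨m, hm, hm', rfl⟩)
end
end
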